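/- arXiv:math/0409105 — 2 statements merged into one kernel-verified Lean document; each statement's English description precedes it below -/
import Mathlib

section
/- For all integers m ≥ 1 and n > m, the number of domino tilings of the holey square 𝓗(m,n) equals 2^(n−m) · (#H(m,n))², and the number #H(m,n) of domino tilings of H(m,n) is odd. In particular #𝓗(m,n) = 2^(n−m)·(2k+1)² for some natural number k. -/
/-- Two cells of `ℤ × ℤ` are adjacent if they differ by `(1,0)` or `(0,1)`. -/
def Adjacent (a b : ℤ × ℤ) : Prop :=
  (a.1 = b.1 ∧ (a.2 = b.2 + 1 ∨ b.2 = a.2 + 1)) ∨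
  (a.2 = b.2 ∧ (a.1 = b.1 + 1 ∨ b.1 = a.1 + 1))

/-- `T` is a domino tiling of `R`: a partition of `R` into two-element sets of adjacent cells. -/
def IsDominoTiling (R : Set (ℤ × ℤ)) (T : Set (Set (ℤ × ℤ))) : Prop :=
  (∀ d ∈ T, ∃ a b, Adjacent a b ∧ d = {a, b}) ∧
  T.PairwiseDisjoint id ∧
  ⋃₀ T = R

/-- The number of domino tilings of `R`. -/
noncomputable def numTilings (R : Set (ℤ × ℤ)) : ℕ :=
  Nat.card {T : Set (Set (ℤ × ℤ)) // IsDominoTiling R T}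

/-- The holey square `𝓗(m,n)`: the `2n × 2n` square with a centered `2m × 2m` hole. -/
def holeySquare (m n : ℕ) : Set (ℤ × ℤ) :=
  {q | 0 ≤ q.1 ∧ q.1 < 2 * n ∧ 0 ≤ q.2 ∧ q.2 < 2 * n ∧
    ¬((n : ℤ) - m ≤ q.1 ∧ q.1 < (n : ℤ) + m ∧ (n : ℤ) - m ≤ q.2 ∧ q.2 < (n : ℤ) + m)}

/-- The region `H(m,n)`: the lower half of the holey square cut along the staircase. -/
def Hreg (m n : ℕ) : Set (ℤ × ℤ) :=
  {q | 0 ≤ q.1 ∧ q.1 < 2 * n ∧ 0 ≤ q.2 ∧ q.2 ≤ 2 * (n : ℤ) - 2 - 2 * (q.1 / 2) ∧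
    ¬((n : ℤ) - m ≤ q.1 ∧ q.1 < (n : ℤ) + m ∧ (n : ℤ) - m ≤ q.2 ∧ q.2 < (n : ℤ) + m)}


/-- `μ` is the partner function of a perfect matching of `R`. -/
def IsM (R : Set (ℤ × ℤ)) (μ : ℤ × ℤ → ℤ × ℤ) : Prop :=
  (∀ c, c ∉ R → μ c = c) ∧ (∀ c, μ (μ c) = c) ∧ ∀ c ∈ R, Adjacent c (μ c)

theorem Adjacent.symm' {a b : ℤ × ℤ} (h : Adjacent a b) : Adjacent b a := by
  unfold Adjacent at *; omega

theorem Adjacent.ne' {a b : ℤ × ℤ} (h : Adjacent a b) : a ≠ b := by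
  rintro rfl; unfold Adjacent at *; omega

theorem IsM.mem {R : Set (ℤ × ℤ)} {μ} (h : IsM R μ) {c} (hc : c ∈ R) : μ c ∈ R := by
  by_contra hn
  have h1 := h.1 _ hn
  rw [h.2.1] at h1
  exact (h.2.2 c hc).ne' h1

theorem IsM.mem_iff {R : Set (ℤ × ℤ)} {μ} (h : IsM R μ) {c} : μ c ∈ R ↔ c ∈ R :=
  ⟨fun hc => by have := h.mem hc; rwa [h.2.1] at this, h.mem⟩

theorem IsM.inj {R : Set (ℤ × ℤ)} {μ} (h : IsM R μ) {c d} (e : μ c = μ d) : c = d := by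
  rw [← h.2.1 c, e, h.2.1]

/-- matchings as a type -/
abbrev Mat (R : Set (ℤ × ℤ)) := {μ : ℤ × ℤ → ℤ × ℤ // IsM R μ}

theorem finite_Mat {R : Set (ℤ × ℤ)} (hR : R.Finite) : Finite (Mat R) := by
  have : Finite R := hR
  let F : Mat R → (R → R) := fun μ c => ⟨μ.1 c.1, μ.2.mem c.2⟩
  refine Finite.of_injective F ?_
  intro μ ν h
  apply Subtype.ext
  funext c
  by_cases hc : c ∈ R
  · have := congrFun h ⟨c, hc⟩
    exact congrArg Subtype.val this
  · rw [μ.2.1 c hc, ν.2.1 c hc]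

theorem tiling_of_mat {R : Set (ℤ × ℤ)} {μ} (h : IsM R μ) :
    IsDominoTiling R {d | ∃ c ∈ R, d = {c, μ c}} := by
  refine ⟨?_, ?_, ?_⟩
  · rintro d ⟨c, hc, rfl⟩
    exact ⟨c, μ c, h.2.2 c hc, rfl⟩
  · rintro d ⟨c, hc, rfl⟩ e ⟨c', hc', rfl⟩ hne
    simp only [Function.onFun, id]
    rw [Set.disjoint_left]
    intro x hx hx'
    apply hne
    have key : ∀ c, x ∈ ({c, μ c} : Set (ℤ × ℤ)) → ({c, μ c} : Set (ℤ × ℤ)) = {x, μ x} := by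
      rintro c (rfl | hx)
      · rfl
      · rw [Set.mem_singleton_iff] at hx
        subst hx
        rw [h.2.1, Set.pair_comm]
    rw [key c hx, key c' hx']
  · ext x
    simp only [Set.mem_sUnion, Set.mem_ofPred_eq]
    constructor
    · rintro ⟨d, ⟨c, hc, rfl⟩, hx | hx⟩
      · rw [hx]; exact hc
      · rw [hx]; exact h.mem hc
    · intro hx
      exact ⟨_, ⟨x, hx, rfl⟩, by simp⟩

theorem numTilings_eq (R : Set (ℤ × ℤ)) : numTilings R = Nat.card (Mat R) := by
  unfold numTilings
  symm
  refine Nat.card_eq_of_bijective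
    (fun μ : Mat R => ⟨{d | ∃ c ∈ R, d = {c, μ.1 c}}, tiling_of_mat μ.2⟩) ⟨?_, ?_⟩
  · rintro ⟨μ, hμ⟩ ⟨ν, hν⟩ h
    simp only [Subtype.mk.injEq] at h ⊢
    funext c
    by_cases hc : c ∈ R
    · have h1 : ({c, μ c} : Set (ℤ × ℤ)) ∈ {d : Set (ℤ × ℤ) | ∃ c ∈ R, d = {c, ν c}} := by
        rw [← h]; exact ⟨c, hc, rfl⟩
      obtain ⟨e, he, h2⟩ := h1
      have hne := (hμ.2.2 c hc).ne'
      have hc1 : c ∈ ({e, ν e} : Set (ℤ × ℤ)) := by rw [← h2]; simp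
      have hc2 : μ c ∈ ({e, ν e} : Set (ℤ × ℤ)) := by rw [← h2]; simp
      simp only [Set.mem_insert_iff, Set.mem_singleton_iff] at hc1 hc2
      rcases hc1 with h3 | h3 <;> rcases hc2 with h4 | h4
      · exact absurd (h3.trans h4.symm) hne
      · rw [h4, h3]
      · rw [h4, h3, hν.2.1]
      · exact absurd (h3.trans h4.symm) hne
    · rw [hμ.1 c hc, hν.1 c hc]
  · rintro ⟨T, hT1, hT2, hT3⟩
    have ex : ∀ c ∈ R, ∃ b, Adjacent c b ∧ ({c, b} : Set (ℤ × ℤ)) ∈ T := by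
      intro c hc
      rw [← hT3] at hc
      obtain ⟨d, hd, hcd⟩ := hc
      obtain ⟨a, b, hab, rfl⟩ := hT1 d hd
      rcases hcd with rfl | hcd
      · exact ⟨b, hab, hd⟩
      · rw [Set.mem_singleton_iff] at hcd
        subst hcd
        exact ⟨a, hab.symm', by rwa [Set.pair_comm]⟩
    have uniq : ∀ c b b', Adjacent c b → Adjacent c b' → ({c, b} : Set (ℤ × ℤ)) ∈ T →
        ({c, b'} : Set (ℤ × ℤ)) ∈ T → b = b' := by
      intro c b b' h1 h2 h3 h4
      have : ({c, b} : Set (ℤ × ℤ)) = {c, b'} := by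
        by_contra hne
        have := hT2 h3 h4 hne
        simp only [Function.onFun, id] at this
        rw [Set.disjoint_left] at this
        exact this (a := c) (by simp) (by simp)
      have hb : b ∈ ({c, b'} : Set (ℤ × ℤ)) := by rw [← this]; simp
      rcases hb with hb | hb
      · exact absurd hb.symm h1.ne'
      · exact hb
    classical
    let μ : ℤ × ℤ → ℤ × ℤ := fun c => if hc : c ∈ R then (ex c hc).choose else c
    have hμ1 : ∀ c ∈ R, Adjacent c (μ c) ∧ ({c, μ c} : Set (ℤ × ℤ)) ∈ T := by
      intro c hc
      have := (ex c hc).choose_spec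
      simpa only [μ, dif_pos hc] using this
    have hμ0 : ∀ c, c ∉ R → μ c = c := fun c hc => by simp only [μ, dif_neg hc]
    have hμR : ∀ c ∈ R, μ c ∈ R := by
      intro c hc
      rw [← hT3]
      exact ⟨_, (hμ1 c hc).2, by simp⟩
    have hM : IsM R μ := by
      refine ⟨hμ0, ?_, fun c hc => (hμ1 c hc).1⟩
      intro c
      by_cases hc : c ∈ R
      · obtain ⟨h1, h2⟩ := hμ1 c hc
        obtain ⟨h3, h4⟩ := hμ1 (μ c) (hμR c hc)
        rw [Set.pair_comm] at h2
        exact uniq (μ c) _ _ h3 h1.symm' h4 h2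
      · rw [hμ0 c hc, hμ0 c hc]
    refine ⟨⟨μ, hM⟩, ?_⟩
    apply Subtype.ext
    ext d
    simp only [Set.mem_ofPred_eq]
    constructor
    · rintro ⟨c, hc, rfl⟩
      exact (hμ1 c hc).2
    · intro hd
      obtain ⟨a, b, hab, rfl⟩ := hT1 d hd
      have ha : a ∈ R := by rw [← hT3]; exact ⟨_, hd, by simp⟩
      refine ⟨a, ha, ?_⟩
      rw [uniq a _ _ hab (hμ1 a ha).1 hd (hμ1 a ha).2]

/-- splitting a region -/
theorem card_split (R H K : Set (ℤ × ℤ)) (hR : ∀ c, c ∈ R ↔ c ∈ H ∨ c ∈ K)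
    (hd : ∀ c, c ∈ H → c ∉ K) :
    Nat.card {μ : Mat R // ∀ c ∈ H, μ.1 c ∈ H} = Nat.card (Mat H) * Nat.card (Mat K) := by
  classical
  rw [← Nat.card_prod]
  symm
  have hcomb : ∀ p : Mat H × Mat K, IsM R (fun c => if c ∈ H then p.1.1 c else p.2.1 c) := by
    rintro ⟨⟨μ, hμ⟩, ⟨ν, hν⟩⟩
    refine ⟨?_, ?_, ?_⟩
    · intro c hc
      rw [hR] at hc
      push Not at hc
      simp [hc.1, hν.1 c hc.2]
    · intro c
      by_cases hc : c ∈ H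
      · simp [hc, hμ.mem hc, hμ.2.1]
      · have : ν c ∉ H := by
          by_cases hk : c ∈ K
          · intro h; exact hd _ h (hν.mem hk)
          · rwa [hν.1 c hk]
        simp [hc, this, hν.2.1]
    · intro c hc
      by_cases hh : c ∈ H
      · simpa [hh] using hμ.2.2 c hh
      · have hk : c ∈ K := by rw [hR] at hc; tauto
        simpa [hh] using hν.2.2 c hk
  refine Nat.card_eq_of_bijective (fun p => ⟨⟨_, hcomb p⟩, ?_⟩) ⟨?_, ?_⟩
  · intro c hc
    simp [hc, p.1.2.mem hc]
  · rintro ⟨⟨μ, hμ⟩, ⟨ν, hν⟩⟩ ⟨⟨μ', hμ'⟩, ⟨ν', hν'⟩⟩ h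
    simp only [Subtype.mk.injEq] at h
    have h' := congrFun h
    simp only [Prod.mk.injEq, Subtype.mk.injEq]
    constructor
    · funext c
      by_cases hc : c ∈ H
      · simpa [hc] using h' c
      · rw [hμ.1 c hc, hμ'.1 c hc]
    · funext c
      by_cases hc : c ∈ K
      · have : c ∉ H := fun h => hd c h hc
        simpa [this] using h' c
      · rw [hν.1 c hc, hν'.1 c hc]
  · rintro ⟨⟨μ, hμ⟩, h⟩
    simp only at h
    have hK : ∀ c ∈ K, μ c ∈ K := by
      intro c hc
      have h1 : μ c ∈ R := hμ.mem ((hR c).2 (Or.inr hc))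
      rcases (hR _).1 h1 with h2 | h2
      · have := h _ h2
        rw [hμ.2.1] at this
        exact absurd hc (hd c this)
      · exact h2
    have hM1 : IsM H (fun c => if c ∈ H then μ c else c) := by
      refine ⟨fun c hc => by simp [hc], fun c => ?_, fun c hc => ?_⟩
      · by_cases hc : c ∈ H
        · simp [hc, h c hc, hμ.2.1]
        · simp [hc]
      · simpa [hc] using hμ.2.2 c ((hR c).2 (Or.inl hc))
    have hM2 : IsM K (fun c => if c ∈ K then μ c else c) := by
      refine ⟨fun c hc => by simp [hc], fun c => ?_, fun c hc => ?_⟩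
      · by_cases hc : c ∈ K
        · simp [hc, hK c hc, hμ.2.1]
        · simp [hc]
      · simpa [hc] using hμ.2.2 c ((hR c).2 (Or.inr hc))
    refine ⟨(⟨_, hM1⟩, ⟨_, hM2⟩), ?_⟩
    apply Subtype.ext
    apply Subtype.ext
    funext c
    by_cases hc : c ∈ H
    · simp [hc]
    · by_cases hk : c ∈ K
      · simp [hc, hk]
      · have : c ∉ R := by rw [hR]; tauto
        simp [hc, hk, hμ.1 c this]

theorem IsM.conj {R : Set (ℤ × ℤ)} {μ} (h : IsM R μ) (K : Set (ℤ × ℤ)) (ρ : ℤ × ℤ → ℤ × ℤ)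
    (h1 : ∀ c, ρ (ρ c) = c) (h2 : ∀ c d, Adjacent c d → Adjacent (ρ c) (ρ d))
    (h3 : ∀ c, c ∈ K ↔ ρ c ∈ R) : IsM K (fun c => ρ (μ (ρ c))) := by
  refine ⟨fun c hc => ?_, fun c => ?_, fun c hc => ?_⟩
  · rw [h3] at hc
    simp only [h.1 _ hc, h1]
  · simp only [h1, h.2.1]
  · have := h2 _ _ (h.2.2 _ ((h3 c).1 hc))
    rwa [h1] at this

theorem card_conj (R K : Set (ℤ × ℤ)) (ρ : ℤ × ℤ → ℤ × ℤ)
    (h1 : ∀ c, ρ (ρ c) = c) (h2 : ∀ c d, Adjacent c d → Adjacent (ρ c) (ρ d))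
    (h3 : ∀ c, c ∈ K ↔ ρ c ∈ R) : Nat.card (Mat R) = Nat.card (Mat K) := by
  refine Nat.card_congr ⟨fun μ => ⟨_, μ.2.conj K ρ h1 h2 h3⟩,
    fun μ => ⟨_, μ.2.conj R ρ h1 h2 (fun c => by rw [h3, h1])⟩, fun μ => ?_, fun μ => ?_⟩
  · apply Subtype.ext; funext c; simp only [h1]
  · apply Subtype.ext; funext c; simp only [h1]



theorem odd_card_of_ker (R : Set (ℤ × ℤ)) (hR : R.Finite)
    (hker : ∀ f : ℤ × ℤ → ZMod 2, (∀ c, c ∉ R → f c = 0) →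
      (∀ c ∈ R, f (c.1 + 1, c.2) + f (c.1 - 1, c.2) + f (c.1, c.2 + 1) + f (c.1, c.2 - 1) = 0) →
      ∀ c, f c = 0) : Odd (Nat.card (Mat R)) := by
  classical
  have : Fintype R := hR.fintype
  let A : Matrix R R (ZMod 2) := Matrix.of fun i j => if Adjacent i j then 1 else 0
  have hdet : A.det ≠ 0 := by
    intro h0
    obtain ⟨v, hv, hAv⟩ := Matrix.exists_mulVec_eq_zero_iff.2 h0
    apply hv
    let f : ℤ × ℤ → ZMod 2 := fun c => ∑ j : R, if (j : ℤ × ℤ) = c then v j else 0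
    have hfv : ∀ j : R, f j = v j := by
      intro j
      simp only [f]
      rw [Finset.sum_eq_single j]
      · simp
      · intro b _ hb
        rw [if_neg]
        exact fun h => hb (Subtype.ext h)
      · simp
    have := hker f ?_ ?_
    · funext j
      rw [← hfv, this]; rfl
    · intro c hc
      apply Finset.sum_eq_zero
      intro j _
      rw [if_neg]
      rintro rfl
      exact hc j.2
    · intro c hc
      have h1 := congrFun hAv ⟨c, hc⟩
      simp only [Matrix.mulVec, dotProduct, Pi.zero_apply] at h1
      rw [← h1]
      simp only [f]
      rw [← Finset.sum_add_distrib, ← Finset.sum_add_distrib, ← Finset.sum_add_distrib]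
      apply Finset.sum_congr rfl
      rintro ⟨⟨x, y⟩, hj⟩ _
      obtain ⟨p, q⟩ := c
      by_cases hadj : Adjacent (p, q) (x, y)
      · simp only [A, Matrix.of_apply, if_pos hadj, Prod.mk.injEq]
        simp only [Adjacent] at hadj
        split_ifs <;> first | (exfalso; omega) | simp
      · simp only [A, Matrix.of_apply, if_neg hadj, Prod.mk.injEq]
        simp only [Adjacent] at hadj
        split_ifs <;> first | (exfalso; omega) | simp
  have hsum : A.det = ((Finset.univ.filter
      (fun σ : Equiv.Perm R => (∀ i, Adjacent (σ i) i) ∧ σ * σ = 1)).card : ZMod 2) := by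
    rw [Matrix.det_apply]
    have h1 : ∀ σ : Equiv.Perm R, (Equiv.Perm.sign σ • ∏ i, A (σ i) i : ZMod 2)
        = if (∀ i, Adjacent (σ i) i) then 1 else 0 := by
      intro σ
      have : ∏ i, A (σ i) i = if (∀ i, Adjacent (σ i) i) then (1 : ZMod 2) else 0 := by
        simp only [A, Matrix.of_apply]
        rw [Finset.prod_ite_zero]
        simp
      rw [this]
      rcases Int.units_eq_one_or (Equiv.Perm.sign σ) with h | h <;> rw [h]
      · simp
      · rw [Units.neg_smul, one_smul, CharTwo.neg_eq]
    rw [Finset.sum_congr rfl (fun σ _ => h1 σ), ← Finset.sum_filter,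
      ← Finset.sum_filter_add_sum_filter_not _ (fun σ : Equiv.Perm R => σ * σ = 1),
      Finset.filter_filter, Finset.filter_filter]
    have h2 : ∑ σ ∈ Finset.univ.filter
        (fun σ : Equiv.Perm R => (∀ i, Adjacent (σ i) i) ∧ ¬ σ * σ = 1), (1 : ZMod 2) = 0 := by
      refine Finset.sum_involution (fun σ _ => σ⁻¹) ?_ ?_ ?_ ?_
      · intros; exact CharTwo.add_self_eq_zero _
      · intro σ hσ _ h
        rw [Finset.mem_filter] at hσ
        apply hσ.2.2
        nth_rewrite 1 [← h]
        simp
      · intro σ hσ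
        rw [Finset.mem_filter] at hσ ⊢
        refine ⟨Finset.mem_univ _, fun i => ?_, fun h => ?_⟩
        · have := hσ.2.1 (σ⁻¹ i)
          have e : σ (σ⁻¹ i) = i := by simp
          rw [e] at this
          exact this.symm'
        · apply hσ.2.2
          have := congrArg (·⁻¹) h
          simpa using this
      · intros; simp
    rw [h2, add_zero]
    simp
  have hcard : (Finset.univ.filter
      (fun σ : Equiv.Perm R => (∀ i, Adjacent (σ i) i) ∧ σ * σ = 1)).card = Nat.card (Mat R) := by
    rw [← Fintype.card_subtype, ← Nat.card_eq_fintype_card]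
    symm
    have hinv : ∀ μ : Mat R, Function.Involutive
        (fun c : R => (⟨μ.1 c.1, μ.2.mem c.2⟩ : R)) := by
      intro μ c
      apply Subtype.ext
      exact μ.2.2.1 c
    refine Nat.card_eq_of_bijective (fun μ => ⟨(hinv μ).toPerm, fun i => ?_, ?_⟩) ⟨?_, ?_⟩
    · exact (μ.2.2.2 i.1 i.2).symm'
    · ext1 i
      exact hinv μ i
    · intro μ ν h
      simp only [Subtype.mk.injEq] at h
      apply Subtype.ext
      funext c
      by_cases hc : c ∈ R
      · have := congrArg (fun σ : Equiv.Perm R => ((σ ⟨c, hc⟩ : R) : ℤ × ℤ)) h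
        exact this
      · rw [μ.2.1 c hc, ν.2.1 c hc]
    · rintro ⟨σ, h1, h2⟩
      have h2' : ∀ i, σ (σ i) = i := fun i => congrArg (fun τ : Equiv.Perm R => τ i) h2
      have hM : IsM R (fun c => if h : c ∈ R then (σ ⟨c, h⟩ : ℤ × ℤ) else c) := by
        refine ⟨fun c hc => by simp [hc], fun c => ?_, fun c hc => ?_⟩
        · by_cases hc : c ∈ R
          · simp [hc, h2']
          · simp [hc]
        · simpa [hc] using (h1 ⟨c, hc⟩).symm'
      refine ⟨⟨_, hM⟩, ?_⟩
      apply Subtype.ext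
      ext1 i
      apply Subtype.ext
      change (if h : i.1 ∈ R then (σ ⟨i.1, h⟩ : ℤ × ℤ) else i.1) = _
      rw [dif_pos i.2]
  rw [hsum, hcard, ZMod.natCast_ne_zero_iff_odd] at hdet
  exact hdet

/-- The profile of a mod-2 solution along the bottom row. -/
def prof (f : ℤ × ℤ → ZMod 2) : ℕ → ZMod 2
  | 0 => 0
  | 1 => 0
  | (s + 2) => prof f s + f (s, 0)

/-- the value predicted by the d'Alembert formula -/
def pred (f : ℤ × ℤ → ZMod 2) (x y : ℤ) : ZMod 2 :=
  prof f (x + y + 2).natAbs + prof f (x - y).natAbs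

theorem pred_wave (f : ℤ × ℤ → ZMod 2) (x y : ℤ) :
    pred f (x + 1) y + pred f (x - 1) y + pred f x (y + 1) + pred f x (y - 1) = 0 := by
  unfold pred
  rw [show x + 1 + y + 2 = x + (y + 1) + 2 by ring, show x - 1 + y + 2 = x + (y - 1) + 2 by ring,
    show x + 1 - y = x - (y - 1) by ring, show x - 1 - y = x - (y + 1) by ring]
  generalize prof f (x + (y + 1) + 2).natAbs = a
  generalize prof f (x + (y - 1) + 2).natAbs = b
  generalize prof f (x - (y - 1)).natAbs = c
  generalize prof f (x - (y + 1)).natAbs = d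
  revert a b c d
  decide

theorem zm_eq {a b : ZMod 2} (h : a + b = 0) : a = b := by
  revert a b; decide

theorem zm_four {a b c d a' b' c' d' : ZMod 2} (h : a + b + c + d = 0)
    (h' : a' + b' + c' + d' = 0) (ha : a = a') (hb : b = b') (hd : d = d') : c = c' := by
  revert a b c d a' b' c' d'; decide

theorem ker_Hreg (m n : ℕ) (hmn : m < n) (f : ℤ × ℤ → ZMod 2)
    (h0 : ∀ c, c ∉ Hreg m n → f c = 0)
    (h1 : ∀ c ∈ Hreg m n,
      f (c.1 + 1, c.2) + f (c.1 - 1, c.2) + f (c.1, c.2 + 1) + f (c.1, c.2 - 1) = 0) :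
    ∀ c, f c = 0 := by
  obtain ⟨k, rfl⟩ : ∃ k : ℕ, n = m + k := ⟨n - m, by omega⟩
  set n := m + k with hn
  have H0 : ∀ x y : ℤ, ¬ (0 ≤ x ∧ x < 2 * n ∧ 0 ≤ y ∧ y ≤ 2 * (n : ℤ) - 2 - 2 * (x / 2) ∧
      ¬((k : ℤ) ≤ x ∧ k ≤ y)) → f (x, y) = 0 := by
    intro x y h
    apply h0
    simp only [Hreg, Set.mem_ofPred_eq]
    push_cast at *
    omega
  have H1 : ∀ x y : ℤ, (0 ≤ x ∧ x < 2 * n ∧ 0 ≤ y ∧ y ≤ 2 * (n : ℤ) - 2 - 2 * (x / 2) ∧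
      ¬((k : ℤ) ≤ x ∧ k ≤ y)) →
      f (x + 1, y) + f (x - 1, y) + f (x, y + 1) + f (x, y - 1) = 0 := by
    intro x y h
    apply h1 (x, y)
    simp only [Hreg, Set.mem_ofPred_eq]
    push_cast at *
    omega
  clear h0 h1
  have main : ∀ j : ℕ, ∀ x y : ℤ, y ≤ j → -1 ≤ x → -1 ≤ y → x + y ≤ 2 * n - 1 →
      (x ≤ k ∨ y ≤ k) → f (x, y) = pred f x y := by
    intro j
    induction j with
    | zero =>
      intro x y hy hx hy' hxy hk
      rcases (show y = -1 ∨ y = 0 by omega) with hy | hy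
      · have : y = -1 := by omega
        subst this
        rw [H0 _ _ (by omega), pred]
        rw [show (x + -1 + 2).natAbs = (x - -1).natAbs by congr 1; ring, CharTwo.add_self_eq_zero]
      · have : y = 0 := by omega
        subst this
        rw [pred]
        by_cases hx0 : x = -1
        · subst hx0
          rw [H0 _ _ (by omega)]
          simp [prof]
        · obtain ⟨s, rfl⟩ := Int.eq_ofNat_of_zero_le (show 0 ≤ x by omega)
          rw [show ((s : ℤ) + 0 + 2).natAbs = s + 2 by omega,
            show ((s : ℤ) - 0).natAbs = s by omega, prof]
          rw [add_assoc, add_comm, add_assoc, CharTwo.add_self_eq_zero, add_zero]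
    | succ j ih =>
      intro x y' hy hx hy' hxy hk
      rcases (show y' ≤ j ∨ y' = j + 1 by omega) with hy | hy
      · exact ih x y' (by omega) hx hy' hxy hk
      · obtain ⟨y, rfl⟩ : ∃ y, y' = y + 1 := ⟨y' - 1, by ring⟩
        by_cases hx0 : x = -1
        · subst hx0
          rw [H0 _ _ (by omega), pred]
          rw [show (-1 - (y + 1)).natAbs = (-1 + (y + 1) + 2).natAbs by omega,
            CharTwo.add_self_eq_zero]
        by_cases hc : y + 1 ≤ k ∨ x < k
        · refine zm_four (H1 x y (by omega)) (pred_wave f x y) ?_ ?_ ?_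
          · exact ih _ _ (by omega) (by omega) (by omega) (by omega) (by omega)
          · exact ih _ _ (by omega) (by omega) (by omega) (by omega) (by omega)
          · exact ih _ _ (by omega) (by omega) (by omega) (by omega) (by omega)
        · have hxk : x = k := by omega
          subst hxk
          have e1 := ih (y + 1) k (by omega) (by omega) (by omega) (by omega) (by omega)
          rw [H0 _ _ (by omega), pred] at e1
          rw [H0 _ _ (by omega), pred, e1]
          rw [show (y + 1 + (k : ℤ) + 2).natAbs = ((k : ℤ) + (y + 1) + 2).natAbs by omega,
            show (y + 1 - (k : ℤ)).natAbs = ((k : ℤ) - (y + 1)).natAbs by omega]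
  have P : ∀ x y : ℤ, -1 ≤ x → -1 ≤ y → x + y ≤ 2 * n - 1 →
      (x ≤ k ∨ y ≤ k) → f (x, y) = pred f x y := fun x y h1 h2 h3 h4 =>
    main y.toNat x y (by omega) h1 h2 h3 h4
  have per : ∀ s : ℕ, s + (2 * k + 2) ≤ 2 * n + 1 → prof f s = prof f (s + (2 * k + 2)) := by
    intro s hs
    have e := P (s + k) k (by omega) (by omega) (by omega) (by omega)
    rw [H0 _ _ (by omega), pred] at e
    rw [show ((s : ℤ) + k + k + 2).natAbs = s + (2 * k + 2) by omega,
      show ((s : ℤ) + k - k).natAbs = s by omega] at e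
    exact (zm_eq e.symm).symm
  have win1 : ∀ i : ℕ, i ≤ k → prof f (2 * n + 1 - 2 * i) = prof f (2 * n + 1) := by
    intro i hi
    rcases Nat.even_or_odd' i with ⟨t, rfl | rfl⟩
    · rcases t with _ | j
      · rfl
      · have e := P (2 * n - 2 - 2 * j) (2 * j + 1) (by omega) (by omega) (by omega) (by omega)
        rw [H0 _ _ (by omega), pred] at e
        rw [show (2 * (n : ℤ) - 2 - 2 * j + (2 * j + 1) + 2).natAbs = 2 * n + 1 by omega,
          show (2 * (n : ℤ) - 2 - 2 * j - (2 * j + 1)).natAbs = 2 * n + 1 - 2 * (2 * (j + 1)) by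
            omega] at e
        exact (zm_eq e.symm).symm
    · have e := P (2 * t) (2 * n - 1 - 2 * t) (by omega) (by omega) (by omega) (by omega)
      rw [H0 _ _ (by omega), pred] at e
      rw [show (2 * (t : ℤ) + (2 * n - 1 - 2 * t) + 2).natAbs = 2 * n + 1 by omega,
          show (2 * (t : ℤ) - (2 * n - 1 - 2 * t)).natAbs = 2 * n + 1 - 2 * (2 * t + 1) by
            omega] at e
      exact (zm_eq e.symm).symm
  have link : ∀ x y : ℤ, x + y = 2 * n - 1 → x % 2 = 1 → 0 ≤ x → 0 ≤ y → (x < k ∨ y < k) →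
      prof f (x - 1 - y).natAbs = prof f (x + 1 - y).natAbs := by
    intro x y h1 h2 h3 h4 h5
    have e := H1 x y (by omega)
    rw [H0 (x + 1) y (by omega), H0 x (y + 1) (by omega),
      P (x - 1) y (by omega) (by omega) (by omega) (by omega),
      P x (y - 1) (by omega) (by omega) (by omega) (by omega), pred, pred] at e
    rw [show x - 1 + y + 2 = x + (y - 1) + 2 by ring, show x - (y - 1) = x + 1 - y by ring] at e
    generalize prof f (x + (y - 1) + 2).natAbs = a at e
    generalize prof f (x - 1 - y).natAbs = b at e ⊢
    generalize prof f (x + 1 - y).natAbs = c at e ⊢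
    revert a b c
    decide
  have link2 : ∀ i : ℕ, i + 1 ≤ k → prof f (2 * n - 2 * (i + 1)) = prof f (2 * n - 2 * i) := by
    intro i hi
    rcases Nat.even_or_odd' i with ⟨t, rfl | rfl⟩
    · have e := link (2 * n - 1 - 2 * t) (2 * t) (by omega) (by omega) (by omega) (by omega)
        (by omega)
      rw [show (2 * (n : ℤ) - 1 - 2 * t - 1 - 2 * t).natAbs = 2 * n - 2 * (2 * t + 1) by omega,
        show (2 * (n : ℤ) - 1 - 2 * t + 1 - 2 * t).natAbs = 2 * n - 2 * (2 * t) by omega] at e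
      exact e
    · have e := link (2 * t + 1) (2 * n - 2 - 2 * t) (by omega) (by omega) (by omega) (by omega)
        (by omega)
      rw [show (2 * (t : ℤ) + 1 - 1 - (2 * n - 2 - 2 * t)).natAbs = 2 * n - 2 * (2 * t + 1) by
          omega,
        show (2 * (t : ℤ) + 1 + 1 - (2 * n - 2 - 2 * t)).natAbs = 2 * n - 2 * (2 * t + 1 + 1) by
          omega] at e
      exact e.symm
  have win0 : ∀ i : ℕ, i ≤ k → prof f (2 * n - 2 * i) = prof f (2 * n) := by
    intro i
    induction i with
    | zero => intro _; rfl
    | succ i ih => intro hi; rw [link2 i hi, ih (by omega)]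
  have all : ∀ j s : ℕ, s + j = 2 * n + 1 → prof f s = prof f (2 * n + s % 2) := by
    intro j
    induction j using Nat.strong_induction_on with
    | _ j ih =>
      intro s hs
      by_cases h : s + (2 * k + 2) ≤ 2 * n + 1
      · rw [per s h, ih (j - (2 * k + 2)) (by omega) _ (by omega)]
        congr 2
        omega
      · rcases Nat.even_or_odd' s with ⟨t, rfl | rfl⟩
        · have := win0 (n - t) (by omega)
          rw [show 2 * n - 2 * (n - t) = 2 * t by omega] at this
          rw [this]; congr 1; omega
        · have := win1 (n - t) (by omega)
          rw [show 2 * n + 1 - 2 * (n - t) = 2 * t + 1 by omega] at this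
          rw [this]; congr 1; omega
  rintro ⟨x, y⟩
  by_cases hc : (0 ≤ x ∧ x < 2 * n ∧ 0 ≤ y ∧ y ≤ 2 * (n : ℤ) - 2 - 2 * (x / 2) ∧
      ¬((k : ℤ) ≤ x ∧ k ≤ y))
  · rw [P x y (by omega) (by omega) (by omega) (by omega), pred,
      all (2 * n + 1 - (x + y + 2).natAbs) (x + y + 2).natAbs (by omega),
      all (2 * n + 1 - (x - y).natAbs) (x - y).natAbs (by omega),
      show (x - y).natAbs % 2 = (x + y + 2).natAbs % 2 by omega, CharTwo.add_self_eq_zero]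
  · exact H0 x y hc

theorem finite_box {R : Set (ℤ × ℤ)} (n : ℤ)
    (h : ∀ c ∈ R, 0 ≤ c.1 ∧ c.1 < n ∧ 0 ≤ c.2 ∧ c.2 < n) : R.Finite := by
  refine Set.Finite.subset ((Set.finite_Ico (0 : ℤ) n).prod (Set.finite_Ico (0 : ℤ) n)) ?_
  intro c hc
  have := h c hc
  simp only [Set.mem_prod, Set.mem_Ico]
  omega

theorem odd_Hreg (m n : ℕ) (hmn : m < n) : Odd (Nat.card (Mat (Hreg m n))) := by
  apply odd_card_of_ker
  · apply finite_box (2 * n)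
    rintro ⟨x, y⟩ h
    simp only [Hreg, Set.mem_ofPred_eq] at h
    simp only
    omega
  · intro f h0 h1
    exact ker_Hreg m n hmn f h0 h1



/-- reflection in the antidiagonal -/
def sg (N : ℤ) (c : ℤ × ℤ) : ℤ × ℤ := (N - c.2, N - c.1)

theorem sg_sg (N : ℤ) (c : ℤ × ℤ) : sg N (sg N c) = c := by simp [sg]

theorem sg_adj (N : ℤ) (c d : ℤ × ℤ) (h : Adjacent c d) : Adjacent (sg N c) (sg N d) := by
  simp only [Adjacent, sg] at *; omega

/-- the orbit of `a` under two maps -/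
inductive Orb (σ μ : ℤ × ℤ → ℤ × ℤ) (a : ℤ × ℤ) : ℤ × ℤ → Prop
  | base : Orb σ μ a a
  | s (c) : Orb σ μ a c → Orb σ μ a (σ c)
  | m (c) : Orb σ μ a c → Orb σ μ a (μ c)

theorem orb_two {σ μ : ℤ × ℤ → ℤ × ℤ} {a : ℤ × ℤ} (hσ : ∀ c, σ (σ c) = c)
    (hμ : ∀ c, μ (μ c) = c) (ha : σ a = a) {w u : ℤ × ℤ} (hw : Orb σ μ a w) (hw' : σ w = w)
    (hwa : w ≠ a) (hu : Orb σ μ a u) (hu' : σ u = u) (hua : u ≠ a) : w = u := by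
  let s : Equiv.Perm (ℤ × ℤ) := Function.Involutive.toPerm σ hσ
  let t : Equiv.Perm (ℤ × ℤ) := Function.Involutive.toPerm μ hμ
  let g := s * t
  have hs : ∀ c, s c = σ c := fun c => rfl
  have hgc : ∀ c, g c = σ (μ c) := fun c => rfl
  have hss : s * s = 1 := by ext1 c; exact hσ c
  have htt : t * t = 1 := by ext1 c; exact hμ c
  have hsi : s⁻¹ = s := inv_eq_of_mul_eq_one_left hss
  have hti : t⁻¹ = t := inv_eq_of_mul_eq_one_left htt
  have hconj : s * g * s⁻¹ = g⁻¹ := by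
    simp only [g, mul_inv_rev, hsi, hti]
    rw [← mul_assoc, hss, one_mul]
  have hpow : ∀ i : ℤ, σ ((g ^ i) a) = (g ^ (-i)) a := by
    intro i
    have h1 : s * g ^ i * s⁻¹ = g ^ (-i) := by rw [← conj_zpow, hconj, inv_zpow, zpow_neg]
    rw [← h1, hsi]
    simp [hs, ha]
  have hrep : ∀ c, Orb σ μ a c → ∃ i : ℤ, c = (g ^ i) a := by
    intro c hc
    induction hc with
    | base => exact ⟨0, by simp⟩
    | s c _ ih =>
      obtain ⟨i, rfl⟩ := ih
      exact ⟨-i, hpow i⟩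
    | m c _ ih =>
      obtain ⟨i, rfl⟩ := ih
      refine ⟨-(i + 1), ?_⟩
      rw [← hpow, add_comm, zpow_add, zpow_one, Equiv.Perm.mul_apply, hgc, hσ]
  have key : ∀ i : ℤ, σ ((g ^ i) a) = (g ^ i) a → (g ^ i) a ≠ a →
      ∃ b : ℤ, 2 * i = MulAction.period g a * (2 * b + 1) := by
    intro i h1 h2
    rw [hpow] at h1
    have h3 : (g ^ (2 * i)) a = a := by
      rw [show 2 * i = i + i by ring, zpow_add, Equiv.Perm.mul_apply, ← h1,
        ← Equiv.Perm.mul_apply, ← zpow_add]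
      simp
    have h4 : (MulAction.period g a : ℤ) ∣ 2 * i := MulAction.zpow_smul_eq_iff_period_dvd.1 h3
    have h5 : ¬ (MulAction.period g a : ℤ) ∣ i := fun h =>
      h2 (MulAction.zpow_smul_eq_iff_period_dvd.2 h)
    obtain ⟨d, hd⟩ := h4
    rcases Int.even_or_odd' d with ⟨b, rfl | rfl⟩
    · exfalso
      apply h5
      exact ⟨b, by linarith⟩
    · exact ⟨b, hd⟩
  obtain ⟨i, rfl⟩ := hrep w hw
  obtain ⟨j, rfl⟩ := hrep u hu
  obtain ⟨b, hb⟩ := key i hw' hwa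
  obtain ⟨b', hb'⟩ := key j hu' hua
  have h6 : (MulAction.period g a : ℤ) ∣ i - j := ⟨b - b', by linarith⟩
  have h7 : (g ^ (i - j)) a = a := MulAction.zpow_smul_eq_iff_period_dvd.2 h6
  nth_rewrite 2 [← h7]
  rw [← Equiv.Perm.mul_apply, ← zpow_add]
  congr 2
  ring

theorem wind_exists (hE vE : ℤ → ℤ → ZMod 2)
    (deg : ∀ x y, hE x y + hE (x - 1) y + vE x y + vE x (y - 1) = 0)
    (h0 : ∀ x y, y < 0 → hE x y = 0) (v0 : ∀ x y, y < 0 → vE x y = 0) :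
    ∃ f : ℤ → ℤ → ZMod 2, (∀ x y, f x y = f x (y - 1) + hE x y) ∧
      (∀ x y, f x y = f (x - 1) y + vE x y) ∧ (∀ x y, y < 0 → f x y = 0) ∧
      (∀ x, (∀ y, hE x y = 0) → ∀ y, f x y = 0) := by
  let f : ℤ → ℤ → ZMod 2 := fun x y => ∑ j ∈ Finset.Ico 0 (y + 1), hE x j
  have f0 : ∀ x y, y < 0 → f x y = 0 := by
    intro x y hy
    simp only [f]
    rw [Finset.Ico_eq_empty (by omega)]; simp
  have f1 : ∀ x y, f x y = f x (y - 1) + hE x y := by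
    intro x y
    by_cases hy : y < 0
    · rw [f0 x y hy, f0 x (y - 1) (by omega), h0 x y hy, add_zero]
    · simp only [f]
      have : Finset.Ico 0 (y + 1) = insert y (Finset.Ico 0 (y - 1 + 1)) := by
        ext j; simp only [Finset.mem_Ico, Finset.mem_insert]; omega
      rw [this, Finset.sum_insert (by simp), add_comm]
  refine ⟨f, f1, ?_, f0, ?_⟩
  · have : ∀ j : ℕ, ∀ x y : ℤ, y + 1 = j → f x y = f (x - 1) y + vE x y := by
      intro j
      induction j with
      | zero =>
        intro x y hy
        rw [f0 x y (by omega), f0 _ y (by omega), v0 x y (by omega), add_zero]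
      | succ j ih =>
        intro x y hy
        rw [f1 x y, f1 (x - 1) y, ih x (y - 1) (by push_cast at hy; omega)]
        have := deg x y
        generalize f (x - 1) (y - 1) = a
        generalize hE x y = b at *
        generalize hE (x - 1) y = c at *
        generalize vE x y = d at *
        generalize vE x (y - 1) = e at *
        revert a b c d e
        decide
    intro x y
    by_cases hy : y < 0
    · rw [f0 x y (by omega), f0 _ y (by omega), v0 x y (by omega), add_zero]
    · exact this (y + 1).toNat x y (by omega)
  · intro x hx y
    exact Finset.sum_eq_zero (fun j _ => hx j)

open Classical in
/-- indicator in `ZMod 2` -/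
noncomputable def ind (P : Prop) : ZMod 2 := if P then 1 else 0

theorem ind_pos {P : Prop} (h : P) : ind P = 1 := if_pos h
theorem ind_neg {P : Prop} (h : ¬ P) : ind P = 0 := if_neg h

theorem deg_one (C : ℤ × ℤ → Prop) (τ : ℤ × ℤ → ℤ × ℤ) (hτ : ∀ c, τ (τ c) = c)
    (hC : ∀ c, C c → C (τ c)) (hadj : ∀ c, C c → Adjacent c (τ c)) (x y : ℤ) :
    ind (C (x, y) ∧ τ (x, y) = (x + 1, y)) + ind (C (x - 1, y) ∧ τ (x - 1, y) = (x - 1 + 1, y))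
    + ind (C (x, y) ∧ τ (x, y) = (x, y + 1)) + ind (C (x, y - 1) ∧ τ (x, y - 1) = (x, y - 1 + 1))
    = ind (C (x, y)) := by
  have key : ∀ c d, (C c ∧ τ c = d) ↔ (C d ∧ τ d = c) := by
    intro c d
    constructor
    · rintro ⟨h1, rfl⟩; exact ⟨hC _ h1, hτ _⟩
    · rintro ⟨h1, rfl⟩; exact ⟨hC _ h1, hτ _⟩
  rw [sub_add_cancel, sub_add_cancel, key (x - 1, y), key (x, y - 1)]
  by_cases h : C (x, y)
  · have := hadj _ h
    rcases hm : τ (x, y) with ⟨a, b⟩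
    rw [hm] at this
    simp only [Adjacent] at this
    simp only [h, true_and, Prod.mk.injEq]
    unfold ind
    split_ifs <;> first | (exfalso; omega) | simp
  · simp [h, ind]

theorem wind_parity (N : ℤ) (hN : N % 2 = 1) (S : Set (ℤ × ℤ))
    (hS : ∀ c, c ∈ S ↔ 0 ≤ c.1 ∧ c.1 ≤ N ∧ 0 ≤ c.2 ∧ c.2 ≤ N)
    (μ : ℤ × ℤ → ℤ × ℤ) (hμ : IsM S μ) (C : ℤ × ℤ → Prop) (hCS : ∀ c, C c → c ∈ S)
    (hCm : ∀ c, C c → C (μ c)) (hCs : ∀ c, C c → C (sg N c)) (p q : ℤ) (hpq : p < q)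
    (hp : C (p, N - p)) (hq : C (q, N - q)) (ho : ∀ x, C (x, N - x) → x = p ∨ x = q) :
    (q - p) % 2 = 1 := by
  classical
  let ν : ℤ × ℤ → ℤ × ℤ := fun c => sg N (μ (sg N c))
  have hSs : ∀ c, c ∈ S ↔ sg N c ∈ S := by
    intro c; rw [hS, hS]; simp only [sg]; omega
  have hν : IsM S ν := hμ.conj S (sg N) (sg_sg N) (sg_adj N) hSs
  have hCn : ∀ c, C c → C (ν c) := fun c hc => hCs _ (hCm _ (hCs _ hc))
  let hE : ℤ → ℤ → ZMod 2 := fun x y =>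
    ind (C (x, y) ∧ μ (x, y) = (x + 1, y)) + ind (C (x, y) ∧ ν (x, y) = (x + 1, y))
  let vE : ℤ → ℤ → ZMod 2 := fun x y =>
    ind (C (x, y) ∧ μ (x, y) = (x, y + 1)) + ind (C (x, y) ∧ ν (x, y) = (x, y + 1))
  have deg : ∀ x y, hE x y + hE (x - 1) y + vE x y + vE x (y - 1) = 0 := by
    intro x y
    have h1 := deg_one C μ hμ.2.1 hCm (fun c hc => hμ.2.2 c (hCS c hc)) x y
    have h2 := deg_one C ν hν.2.1 hCn (fun c hc => hν.2.2 c (hCS c hc)) x y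
    have h3 : ind (C (x, y)) + ind (C (x, y)) = 0 := CharTwo.add_self_eq_zero _
    nth_rewrite 1 [← h1] at h3
    rw [← h2] at h3
    rw [← h3]
    simp only [hE, vE]
    ring
  -- edges at a cell outside `C`
  have z1 : ∀ x y, ¬ C (x, y) → hE x y = 0 := fun x y h => by simp [hE, h, ind]
  have z2 : ∀ x y, ¬ C (x, y) → vE x y = 0 := fun x y h => by simp [vE, h, ind]
  have z3 : ∀ x y, ¬ C (x + 1, y) → hE x y = 0 := by
    intro x y h
    simp only [hE]
    rw [ind_neg, ind_neg, add_zero]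
    · rintro ⟨h1, h2⟩; apply h; rw [← h2]; exact hCn _ h1
    · rintro ⟨h1, h2⟩; apply h; rw [← h2]; exact hCm _ h1
  have z4 : ∀ x y, ¬ C (x, y + 1) → vE x y = 0 := by
    intro x y h
    simp only [vE]
    rw [ind_neg, ind_neg, add_zero]
    · rintro ⟨h1, h2⟩; apply h; rw [← h2]; exact hCn _ h1
    · rintro ⟨h1, h2⟩; apply h; rw [← h2]; exact hCm _ h1
  have out : ∀ x y, (x < 0 ∨ N < x ∨ y < 0 ∨ N < y) → ¬ C (x, y) := by
    intro x y h hc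
    have := (hS _).1 (hCS _ hc)
    simp only at this
    omega
  obtain ⟨f, f1, f2, f3, f4⟩ := wind_exists hE vE deg
    (fun x y h => z1 x y (out x y (by omega))) (fun x y h => z2 x y (out x y (by omega)))
  -- symmetry
  have hsym : ∀ x y, hE x y = vE (N - y) (N - 1 - x) := by
    intro x y
    have e1 : sg N (N - y, N - 1 - x) = (x + 1, y) := by
      simp only [sg, Prod.mk.injEq]; constructor <;> ring
    have e2 : sg N (N - y, N - 1 - x + 1) = (x, y) := by
      simp only [sg, Prod.mk.injEq]; constructor <;> ring
    have e1' : sg N (x + 1, y) = (N - y, N - 1 - x) := by rw [← e1, sg_sg]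
    have e2' : sg N (x, y) = (N - y, N - 1 - x + 1) := by rw [← e2, sg_sg]
    have key : ∀ τ : ℤ × ℤ → ℤ × ℤ, (∀ c, τ (τ c) = c) → (∀ c, C c → C (τ c)) →
        ((C (x, y) ∧ τ (x, y) = (x + 1, y)) ↔ (C (N - y, N - 1 - x) ∧
          sg N (τ (sg N (N - y, N - 1 - x))) = (N - y, N - 1 - x + 1))) := by
      intro τ h1 h2
      rw [e1]
      constructor
      · rintro ⟨h3, h4⟩
        refine ⟨?_, ?_⟩
        · rw [← e1', ← h4]; exact hCs _ (h2 _ h3)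
        · rw [← h4, h1, e2']
      · rintro ⟨h3, h4⟩
        have h5 : τ (x + 1, y) = (x, y) := by rw [← e2, ← h4, sg_sg]
        have h6 : C (x + 1, y) := by rw [← e1]; exact hCs _ h3
        refine ⟨by rw [← h5]; exact h2 _ h6, by rw [← h5, h1]⟩
    have k1 := key μ hμ.2.1 hCm
    have k2 := key ν hν.2.1 hCn
    simp only [hE, vE]
    rw [k1, k2, add_comm]
    simp only [ν, sg_sg]
  have fsym : ∀ j : ℕ, ∀ x y : ℤ, y + 1 = j → f (N - 1 - y) (N - 1 - x) = f x y := by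
    intro j
    induction j with
    | zero =>
      intro x y hy
      rw [f3 x y (by omega), f4 _ (fun y' => z3 _ y' (out _ _ (by omega)))]
    | succ j ih =>
      intro x y hy
      rw [f1 x y, ← ih x (y - 1) (by push_cast at hy; omega), hsym]
      have := f2 (N - y) (N - 1 - x)
      rw [show N - 1 - (y - 1) = N - y by ring, this, add_assoc, CharTwo.add_self_eq_zero,
        add_zero, show N - y - 1 = N - 1 - y by ring]
  have fs : ∀ c, c ∈ S → ¬ C c → f (sg N c).1 (sg N c).2 = f c.1 c.2 := by
    rintro ⟨x, y⟩ hc hC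
    have hC' : ¬ C (N - y, N - x) := by
      intro h; apply hC
      have := hCs _ h
      simpa [sg] using this
    have hy := (hS _).1 hc
    simp only at hy
    simp only [sg]
    rw [f2, z2 _ _ hC', add_zero, f1, z3 _ _ (by simpa using hC'), add_zero,
      ← fsym (y + 1).toNat x y (by omega)]
    congr 1 <;> ring
  have fm : ∀ c d, Adjacent c d → ¬ C c → ¬ C d → f d.1 d.2 = f c.1 c.2 := by
    have up : ∀ x y, ¬ C (x, y + 1) → f x (y + 1) = f x y := by
      intro x y h; rw [f1, z1 _ _ h]; simp
    have rt : ∀ x y, ¬ C (x + 1, y) → f (x + 1) y = f x y := by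
      intro x y h; rw [f2, z2 _ _ h]; simp
    rintro ⟨x, y⟩ ⟨x', y'⟩ h hc hd
    simp only [Adjacent] at h
    rcases h with ⟨rfl, rfl | rfl⟩ | ⟨rfl, rfl | rfl⟩
    · exact (up _ _ hc).symm
    · exact up _ _ hd
    · exact (rt _ _ hc).symm
    · exact rt _ _ hd
  -- values on the axis
  have ax : ∀ x, f x (N - 1 - x) = f (x - 1) (N - 1 - (x - 1)) + ind (C (x, N - x)) := by
    intro x
    have g1 := f1 x (N - x)
    have g2 := f2 x (N - x)
    have g3 : hE x (N - x) + vE x (N - x) = ind (C (x, N - x)) := by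
      by_cases h : C (x, N - x)
      · have hadj := hμ.2.2 _ (hCS _ h)
        have e : sg N (x, N - x) = (x, N - x) := by simp [sg]
        have hv : ν (x, N - x) = sg N (μ (x, N - x)) := by simp only [ν, e]
        simp only [hE, vE, hv]
        rcases hm : μ (x, N - x) with ⟨a, b⟩
        rw [hm] at hadj
        simp only [Adjacent] at hadj
        simp only [h, true_and, sg, Prod.mk.injEq]
        unfold ind
        split_ifs <;> first | (exfalso; omega) | simp
      · rw [z1 _ _ h, z2 _ _ h, ind_neg h, add_zero]
    rw [← g3, show N - 1 - (x - 1) = N - x by ring, show N - 1 - x = N - x - 1 by ring]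
    generalize f x (N - x) = a at *
    generalize f x (N - x - 1) = b at *
    generalize f (x - 1) (N - x) = c at *
    generalize hE x (N - x) = d at *
    generalize vE x (N - x) = e at *
    clear * - g1 g2
    revert a b c d e
    decide
  have hpS := (hS _).1 (hCS _ hp)
  have hqS := (hS _).1 (hCS _ hq)
  simp only at hpS hqS
  have axv : ∀ j : ℕ, ∀ x : ℤ, x + 1 = j → f x (N - 1 - x) = ind (p ≤ x ∧ x < q) := by
    intro j
    induction j with
    | zero =>
      intro x hx
      rw [ind_neg (by omega), f4 _ (fun y' => z1 _ y' (out _ _ (by omega)))]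
    | succ j ih =>
      intro x hx
      rw [ax, ih (x - 1) (by push_cast at hx; omega)]
      by_cases h1 : x = p
      · subst h1
        rw [ind_pos hp, ind_neg (by omega), ind_pos (by omega), zero_add]
      by_cases h2 : x = q
      · subst h2
        rw [ind_pos hq, ind_pos (by omega), ind_neg (by omega)]; decide
      rw [ind_neg (fun h => (ho x h).elim h1 h2), add_zero]
      congr 1
      apply propext
      omega
  -- the inside
  obtain ⟨I, memI⟩ : ∃ I : Finset (ℤ × ℤ), ∀ c, c ∈ I ↔ c ∈ S ∧ ¬ C c ∧ f c.1 c.2 = 1 := by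
    refine ⟨(Finset.Icc 0 N ×ˢ Finset.Icc 0 N).filter (fun c => ¬ C c ∧ f c.1 c.2 = 1), ?_⟩
    intro c
    simp only [Finset.mem_filter, Finset.mem_product, Finset.mem_Icc, hS]
    tauto
  have Im : ∀ c ∈ I, μ c ∈ I := by
    intro c hc
    rw [memI] at hc ⊢
    have : ¬ C (μ c) := fun h => hc.2.1 (by have := hCm _ h; rwa [hμ.2.1] at this)
    exact ⟨hμ.mem hc.1, this, by rw [fm c (μ c) (hμ.2.2 c hc.1) hc.2.1 this, hc.2.2]⟩
  have Is : ∀ c ∈ I, sg N c ∈ I := by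
    intro c hc
    rw [memI] at hc ⊢
    have : ¬ C (sg N c) := fun h => hc.2.1 (by have := hCs _ h; rwa [sg_sg] at this)
    exact ⟨(hSs c).1 hc.1, this, by rw [fs c hc.1 hc.2.1, hc.2.2]⟩
  have mpar : ∀ c ∈ I, ((μ c).1 + (μ c).2) % 2 = 1 - (c.1 + c.2) % 2 := by
    intro c hc
    have := hμ.2.2 c ((memI c).1 hc).1
    unfold Adjacent at this
    omega
  have card1 : (I.filter (fun c => (c.1 + c.2) % 2 = 1)).card
      = (I.filter (fun c => (c.1 + c.2) % 2 = 0)).card := by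
    refine Finset.card_nbij' μ μ ?_ ?_ ?_ ?_
    · intro c hc
      simp only [Finset.coe_filter, Set.mem_ofPred_eq] at hc ⊢
      have := mpar c hc.1
      exact ⟨Im c hc.1, by omega⟩
    · intro c hc
      simp only [Finset.coe_filter, Set.mem_ofPred_eq] at hc ⊢
      have := mpar c hc.1
      exact ⟨Im c hc.1, by omega⟩
    · intro c _; exact hμ.2.1 c
    · intro c _; exact hμ.2.1 c
  have inv : ∀ T : Finset (ℤ × ℤ), (∀ c ∈ T, sg N c ∈ T) → (∀ c ∈ T, sg N c ≠ c) →
      (T.card : ZMod 2) = 0 := by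
    intro T h1 h2
    rw [Finset.card_eq_sum_ones, Nat.cast_sum]
    refine Finset.sum_involution (fun c _ => sg N c) ?_ ?_ ?_ ?_
    · intros; decide
    · intro c hc _
      exact h2 c hc
    · intro c hc
      exact h1 c hc
    · intro c _; exact sg_sg N c
  have c0 := inv (I.filter (fun c => (c.1 + c.2) % 2 = 0)) (by
    intro c h
    rw [Finset.mem_filter] at h ⊢
    exact ⟨Is c h.1, by simp only [sg]; omega⟩) (by
    intro c h h'
    rw [Finset.mem_filter] at h
    have := congrArg Prod.fst h'
    simp only [sg] at this
    omega)
  have c1 := inv (I.filter (fun c => (c.1 + c.2) % 2 = 1 ∧ ¬ c.1 + c.2 = N)) (by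
    intro c h
    rw [Finset.mem_filter] at h ⊢
    exact ⟨Is c h.1, by simp only [sg]; omega⟩) (by
    intro c h h'
    rw [Finset.mem_filter] at h
    have := congrArg Prod.fst h'
    simp only [sg] at this
    omega)
  have split : (I.filter (fun c => (c.1 + c.2) % 2 = 1)).card
      = (I.filter (fun c => c.1 + c.2 = N)).card
      + (I.filter (fun c => (c.1 + c.2) % 2 = 1 ∧ ¬ c.1 + c.2 = N)).card := by
    rw [← Finset.card_filter_add_card_filter_not (fun c : ℤ × ℤ => c.1 + c.2 = N),
      Finset.filter_filter, Finset.filter_filter]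
    congr 2
    ext c
    simp only [Finset.mem_filter]
    constructor
    · tauto
    · rintro ⟨h1, h2⟩; exact ⟨h1, by omega, h2⟩
  have axcard : (I.filter (fun c => c.1 + c.2 = N)).card = (q - p - 1).toNat := by
    rw [← Int.card_Ioo]
    symm
    refine Finset.card_nbij (fun x => (x, N - x)) ?_ ?_ ?_
    · intro x hx
      simp only [Finset.coe_Ioo, Set.mem_Ioo] at hx
      simp only [Finset.coe_filter, Set.mem_ofPred_eq, memI, hS]
      have hnC : ¬ C (x, N - x) := fun h => by have := ho x h; omega
      refine ⟨⟨by omega, hnC, ?_⟩, by ring⟩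
      rw [f1, z1 _ _ hnC, add_zero, show N - x - 1 = N - 1 - x by ring,
        axv (x + 1).toNat x (by omega), ind_pos (by omega)]
    · intro x _ x' _ h
      simp only [Prod.mk.injEq] at h
      exact h.1
    · rintro ⟨x, y⟩ h
      simp only [Finset.coe_filter, Set.mem_ofPred_eq, memI, hS] at h
      obtain ⟨⟨h1, h2, h3⟩, h4⟩ := h
      obtain rfl : y = N - x := by omega
      refine ⟨x, ?_, rfl⟩
      rw [f1, z1 _ _ h2, add_zero, show N - x - 1 = N - 1 - x by ring,
        axv (x + 1).toNat x (by omega)] at h3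
      have h5 : p ≤ x ∧ x < q := by
        by_contra h; rw [ind_neg h] at h3; exact absurd h3 (by decide)
      have h6 : x ≠ p := by rintro rfl; exact h2 hp
      simp only [Finset.coe_Ioo, Set.mem_Ioo]
      omega
  have fin : (((q - p - 1).toNat : ℕ) : ZMod 2) = 0 := by
    have := congrArg (Nat.cast (R := ZMod 2)) split
    rw [card1, c0, Nat.cast_add, c1, add_zero, axcard] at this
    exact this.symm
  rw [ZMod.natCast_eq_zero_iff] at fin
  omega


theorem axis_orb (m n : ℕ) (N : ℤ) (hN : N = 2 * n - 1) (hmn : m < n) (μ : ℤ × ℤ → ℤ × ℤ)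
    (hμ : IsM (holeySquare m n) μ) (p q : ℤ) (hp : (p, N - p) ∈ holeySquare m n) (hpq : p ≠ q)
    (h : Orb (sg N) μ (p, N - p) (q, N - q)) : (q - p) % 2 = 1 := by
  classical
  have hRs : ∀ c, c ∈ holeySquare m n → sg N c ∈ holeySquare m n := by
    intro c; simp only [holeySquare, sg, Set.mem_ofPred_eq]; omega
  let S : Set (ℤ × ℤ) := {c | 0 ≤ c.1 ∧ c.1 ≤ N ∧ 0 ≤ c.2 ∧ c.2 ≤ N}
  have hS : ∀ c, c ∈ S ↔ 0 ≤ c.1 ∧ c.1 ≤ N ∧ 0 ≤ c.2 ∧ c.2 ≤ N := fun c => Iff.rfl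
  have hRS : ∀ c, c ∈ holeySquare m n → c ∈ S := by
    intro c; simp only [holeySquare, hS, Set.mem_ofPred_eq]; omega
  let C : ℤ × ℤ → Prop := Orb (sg N) μ (p, N - p)
  have hCR : ∀ c, C c → c ∈ holeySquare m n := by
    intro c hc
    induction hc with
    | base => exact hp
    | s c _ ih => exact hRs c ih
    | m c _ ih => exact hμ.mem ih
  let M : ℤ × ℤ → ℤ × ℤ := fun c => if c ∈ holeySquare m n then μ c else
    if c ∈ S then (if (c.1 - (n - m)) % 2 = 0 then (c.1 + 1, c.2) else (c.1 - 1, c.2)) else c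
  have M1 : ∀ c, c ∈ holeySquare m n → M c = μ c := fun c hc => if_pos hc
  have M2 : ∀ c, c ∉ S → M c = c := by
    intro c hc
    simp only [M]
    rw [if_neg (fun h => hc (hRS c h)), if_neg hc]
  have M3 : ∀ c, c ∈ S → c ∉ holeySquare m n → (c.1 - (n - m)) % 2 = 0 →
      M c = (c.1 + 1, c.2) := by
    intro c h1 h2 h3
    simp only [M]
    rw [if_neg h2, if_pos h1, if_pos h3]
  have M4 : ∀ c, c ∈ S → c ∉ holeySquare m n → ¬ (c.1 - (n - m)) % 2 = 0 →
      M c = (c.1 - 1, c.2) := by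
    intro c h1 h2 h3
    simp only [M]
    rw [if_neg h2, if_pos h1, if_neg h3]
  have hM : IsM S M := by
    refine ⟨M2, ?_, ?_⟩
    · intro c
      by_cases h1 : c ∈ holeySquare m n
      · rw [M1 c h1, M1 _ (hμ.mem h1), hμ.2.1]
      by_cases h2 : c ∈ S
      · by_cases h3 : (c.1 - (n - m)) % 2 = 0
        · rw [M3 c h2 h1 h3, M4]
          · simp
          · simp only [holeySquare, hS, Set.mem_ofPred_eq] at *; omega
          · simp only [holeySquare, hS, Set.mem_ofPred_eq] at *; omega
          · simp only; omega
        · rw [M4 c h2 h1 h3, M3]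
          · simp
          · simp only [holeySquare, hS, Set.mem_ofPred_eq] at *; omega
          · simp only [holeySquare, hS, Set.mem_ofPred_eq] at *; omega
          · simp only; omega
      · rw [M2 c h2, M2 c h2]
    · intro c h2
      by_cases h1 : c ∈ holeySquare m n
      · rw [M1 c h1]; exact hμ.2.2 c h1
      · by_cases h3 : (c.1 - (n - m)) % 2 = 0
        · rw [M3 c h2 h1 h3]; simp [Adjacent]
        · rw [M4 c h2 h1 h3]; simp [Adjacent]
  have hCm : ∀ c, C c → C (M c) := by
    intro c hc; rw [M1 c (hCR c hc)]; exact Orb.m c hc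
  have fx : ∀ x, sg N (x, N - x) = (x, N - x) := by intro x; simp [sg]
  have ho : ∀ x, C (x, N - x) → x = p ∨ x = q := by
    intro x hx
    by_cases hxp : x = p
    · exact Or.inl hxp
    · right
      have := orb_two (sg_sg N) hμ.2.1 (fx p) hx (fx x) (by simp [hxp]) h (fx q)
        (by simp [Ne.symm hpq])
      exact congrArg Prod.fst this
  rcases lt_or_gt_of_ne hpq with h1 | h1
  · exact wind_parity N (by omega) S hS M hM C (fun c hc => hRS c (hCR c hc)) hCm
      (fun c hc => Orb.s c hc) p q h1 Orb.base h ho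
  · have := wind_parity N (by omega) S hS M hM C (fun c hc => hRS c (hCR c hc)) hCm
      (fun c hc => Orb.s c hc) q p h1 h Orb.base (fun x hx => (ho x hx).symm)
    omega

open Classical in
/-- reflect the matching along the orbit of `a` -/
noncomputable def flipM (N : ℤ) (a : ℤ × ℤ) (μ : ℤ × ℤ → ℤ × ℤ) (c : ℤ × ℤ) : ℤ × ℤ :=
  if Orb (sg N) μ a c then sg N (μ (sg N c)) else μ c

theorem flipM_pos {N : ℤ} {a : ℤ × ℤ} {μ : ℤ × ℤ → ℤ × ℤ} {c : ℤ × ℤ}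
    (h : Orb (sg N) μ a c) : flipM N a μ c = sg N (μ (sg N c)) := if_pos h
theorem flipM_neg {N : ℤ} {a : ℤ × ℤ} {μ : ℤ × ℤ → ℤ × ℤ} {c : ℤ × ℤ}
    (h : ¬ Orb (sg N) μ a c) : flipM N a μ c = μ c := if_neg h

theorem flipM_orb1 {N : ℤ} {a : ℤ × ℤ} {μ : ℤ × ℤ → ℤ × ℤ} {c : ℤ × ℤ}
    (h : Orb (sg N) (flipM N a μ) a c) : Orb (sg N) μ a c := by
  induction h with
  | base => exact Orb.base
  | s c _ ih => exact Orb.s c ih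
  | m c _ ih =>
    rw [flipM_pos ih]
    exact Orb.s _ (Orb.m _ (Orb.s _ ih))

theorem flipM_orb2 {N : ℤ} {a : ℤ × ℤ} {μ : ℤ × ℤ → ℤ × ℤ} {c : ℤ × ℤ}
    (h : Orb (sg N) μ a c) : Orb (sg N) (flipM N a μ) a c := by
  induction h with
  | base => exact Orb.base
  | s c _ ih => exact Orb.s c ih
  | m c hc ih =>
    have h1 := Orb.s _ (Orb.m _ (Orb.s _ ih))
    rw [flipM_pos (Orb.s _ hc), sg_sg, sg_sg] at h1
    exact h1

theorem flipM_flipM {N : ℤ} {a : ℤ × ℤ} {μ : ℤ × ℤ → ℤ × ℤ} :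
    flipM N a (flipM N a μ) = μ := by
  funext c
  by_cases h : Orb (sg N) μ a c
  · rw [flipM_pos (flipM_orb2 h), flipM_pos (Orb.s _ h), sg_sg, sg_sg]
  · rw [flipM_neg (fun h' => h (flipM_orb1 h')), flipM_neg h]

theorem flipM_isM {N : ℤ} {a : ℤ × ℤ} {μ : ℤ × ℤ → ℤ × ℤ} {R : Set (ℤ × ℤ)} (hμ : IsM R μ)
    (hRs : ∀ c, c ∈ R ↔ sg N c ∈ R) : IsM R (flipM N a μ) := by
  have hν : IsM R (fun c => sg N (μ (sg N c))) := hμ.conj R (sg N) (sg_sg N) (sg_adj N) hRs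
  refine ⟨?_, ?_, ?_⟩
  · intro c hc
    by_cases h : Orb (sg N) μ a c
    · rw [flipM_pos h]; exact hν.1 c hc
    · rw [flipM_neg h]; exact hμ.1 c hc
  · intro c
    by_cases h : Orb (sg N) μ a c
    · rw [flipM_pos h, flipM_pos (Orb.s _ (Orb.m _ (Orb.s _ h)))]; exact hν.2.1 c
    · rw [flipM_neg h, flipM_neg, hμ.2.1]
      intro h'
      apply h
      have := Orb.m _ h'
      rwa [hμ.2.1] at this
  · intro c hc
    by_cases h : Orb (sg N) μ a c
    · rw [flipM_pos h]; exact hν.2.2 c hc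
    · rw [flipM_neg h]; exact hμ.2.2 c hc

/-- the axis cell at `x` is matched upwards -/
def upAt (N : ℤ) (μ : ℤ × ℤ → ℤ × ℤ) (x : ℤ) : Prop :=
  N < (μ (x, N - x)).1 + (μ (x, N - x)).2

theorem halving (m n : ℕ) (N : ℤ) (hN : N = 2 * n - 1) (hmn : m < n) (J : Finset ℤ) :
    (∀ x ∈ J, x % 2 = 0 ∧ (x, N - x) ∈ holeySquare m n) →
    Set.ncard {μ | IsM (holeySquare m n) μ} =
      2 ^ J.card * Set.ncard {μ | IsM (holeySquare m n) μ ∧ ∀ x ∈ J, upAt N μ x} := by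
  have hfin : Set.Finite {μ | IsM (holeySquare m n) μ} := by
    have : (holeySquare m n).Finite := by
      apply finite_box (2 * n)
      intro c hc
      simp only [holeySquare, Set.mem_ofPred_eq] at hc
      push_cast
      omega
    exact finite_Mat this
  have hRs : ∀ c, c ∈ holeySquare m n ↔ sg N c ∈ holeySquare m n := by
    intro c; simp only [holeySquare, sg, Set.mem_ofPred_eq]; omega
  induction J using Finset.induction_on with
  | empty => simp
  | insert a J ha ih =>
    intro hJ
    have haR := hJ a (Finset.mem_insert_self a J)
    rw [ih (fun x hx => hJ x (Finset.mem_insert_of_mem hx)), Finset.card_insert_of_notMem ha,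
      pow_succ, mul_assoc]
    congr 1
    have hfl : ∀ μ, IsM (holeySquare m n) μ →
        (upAt N (flipM N (a, N - a) μ) a ↔ ¬ upAt N μ a) := by
      intro μ hμ
      have h1 := hμ.2.2 _ haR.2
      have h2 : sg N (a, N - a) = (a, N - a) := by simp [sg]
      unfold upAt
      rw [flipM_pos Orb.base, h2]
      simp only [sg]
      unfold Adjacent at h1
      omega
    have hfl2 : ∀ μ, IsM (holeySquare m n) μ → (∀ x ∈ J, upAt N μ x) →
        ∀ x ∈ J, upAt N (flipM N (a, N - a) μ) x := by
      intro μ hμ h x hx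
      have hxa : a ≠ x := by rintro rfl; exact ha hx
      have h3 := hJ x (Finset.mem_insert_of_mem hx)
      unfold upAt
      rw [flipM_neg]
      · exact h x hx
      · intro ho
        have := axis_orb m n N hN hmn μ hμ a x haR.2 hxa ho
        omega
    have hs := Set.ncard_inter_add_ncard_sdiff_eq_ncard
      {μ | IsM (holeySquare m n) μ ∧ ∀ x ∈ J, upAt N μ x} {μ | upAt N μ a}
      (hfin.subset (fun μ h => h.1))
    rw [← hs]
    have e1 : {μ | IsM (holeySquare m n) μ ∧ ∀ x ∈ J, upAt N μ x} ∩ {μ | upAt N μ a}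
        = {μ | IsM (holeySquare m n) μ ∧ ∀ x ∈ insert a J, upAt N μ x} := by
      ext μ
      simp only [Set.mem_inter_iff, Set.mem_ofPred_eq, Finset.mem_insert, forall_eq_or_imp]
      tauto
    have e2 : ({μ | IsM (holeySquare m n) μ ∧ ∀ x ∈ J, upAt N μ x} \ {μ | upAt N μ a}).ncard
        = ({μ | IsM (holeySquare m n) μ ∧ ∀ x ∈ J, upAt N μ x} ∩ {μ | upAt N μ a}).ncard := by
      refine Set.ncard_congr (fun μ _ => flipM N (a, N - a) μ) ?_ ?_ ?_
      · rintro μ ⟨⟨h1, h2⟩, h3⟩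
        exact ⟨⟨flipM_isM h1 hRs, hfl2 μ h1 h2⟩, (hfl μ h1).2 h3⟩
      · intro μ ν _ _ h
        have := congrArg (flipM N (a, N - a)) h
        rwa [flipM_flipM, flipM_flipM] at this
      · rintro μ ⟨⟨h1, h2⟩, h3⟩
        refine ⟨flipM N (a, N - a) μ, ⟨⟨flipM_isM h1 hRs, hfl2 μ h1 h2⟩, ?_⟩, flipM_flipM⟩
        intro h4
        exact (hfl μ h1).1 h4 h3
    rw [e2, e1]
    ring

theorem odd_down (m n : ℕ) (N : ℤ) (hN : N = 2 * n - 1) (μ : ℤ × ℤ → ℤ × ℤ)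
    (hμ : IsM (holeySquare m n) μ)
    (hup : ∀ x, x % 2 = 0 → (x, N - x) ∈ holeySquare m n → upAt N μ x)
    (x : ℤ) (hx : x % 2 = 1) (hxR : (x, N - x) ∈ holeySquare m n) :
    (μ (x, N - x)).1 + (μ (x, N - x)).2 < N := by
  classical
  have hRf : (holeySquare m n).Finite := by
    apply finite_box (2 * n)
    intro c hc
    simp only [holeySquare, Set.mem_ofPred_eq] at hc
    push_cast
    omega
  obtain ⟨F, hF⟩ : ∃ F : Finset (ℤ × ℤ), ∀ c, c ∈ F ↔ c ∈ holeySquare m n :=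
    ⟨hRf.toFinset, fun c => by simp⟩
  have hFs : ∀ c, c ∈ F → sg N c ∈ F := by
    intro c; simp only [hF, holeySquare, sg, Set.mem_ofPred_eq]; omega
  have hFw : ∀ c, c ∈ F → c.swap ∈ F := by
    intro c; simp only [hF, holeySquare, Prod.fst_swap, Prod.snd_swap, Set.mem_ofPred_eq]; omega
  let s : ℤ × ℤ → ℤ := fun c => if c.1 + c.2 < N then -1 else if c.1 + c.2 = N then 0 else 1
  let g : ℤ × ℤ → ℤ := fun c => if c.1 + c.2 = N then (if c.1 % 2 = 1 then 1 else -1) else 0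
  have hs0 : ∀ r : ℤ, ∑ c ∈ F.filter (fun c => (c.1 + c.2) % 2 = r), s c = 0 := by
    intro r
    have : ∑ c ∈ F.filter (fun c => (c.1 + c.2) % 2 = r), s c
        = ∑ c ∈ F.filter (fun c => (c.1 + c.2) % 2 = r), - s c := by
      refine Finset.sum_nbij' (sg N) (sg N) ?_ ?_ ?_ ?_ ?_
      · intro c hc
        rw [Finset.mem_filter] at hc ⊢
        exact ⟨hFs c hc.1, by simp only [sg]; omega⟩
      · intro c hc
        rw [Finset.mem_filter] at hc ⊢
        exact ⟨hFs c hc.1, by simp only [sg]; omega⟩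
      · intro c _; exact sg_sg N c
      · intro c _; exact sg_sg N c
      · intro c _
        simp only [s, sg]
        split_ifs <;> omega
    rw [Finset.sum_neg_distrib] at this
    omega
  have hg0 : ∑ c ∈ F.filter (fun c => (c.1 + c.2) % 2 = 1), g c = 0 := by
    have : ∑ c ∈ F.filter (fun c => (c.1 + c.2) % 2 = 1), g c
        = ∑ c ∈ F.filter (fun c => (c.1 + c.2) % 2 = 1), - g c := by
      refine Finset.sum_nbij' Prod.swap Prod.swap ?_ ?_ ?_ ?_ ?_
      · intro c hc
        rw [Finset.mem_filter] at hc ⊢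
        exact ⟨hFw c hc.1, by simp only [Prod.fst_swap, Prod.snd_swap]; omega⟩
      · intro c hc
        rw [Finset.mem_filter] at hc ⊢
        exact ⟨hFw c hc.1, by simp only [Prod.fst_swap, Prod.snd_swap]; omega⟩
      · intro c _; exact Prod.swap_swap c
      · intro c _; exact Prod.swap_swap c
      · intro c _
        simp only [g, Prod.fst_swap, Prod.snd_swap]
        split_ifs <;> omega
    rw [Finset.sum_neg_distrib] at this
    omega
  have hm0 : ∑ c ∈ F.filter (fun c => (c.1 + c.2) % 2 = 1), s (μ c) = 0 := by
    rw [← hs0 0]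
    have mp : ∀ c ∈ F, ((μ c).1 + (μ c).2) % 2 = 1 - (c.1 + c.2) % 2 := by
      intro c hc
      have := hμ.2.2 c ((hF c).1 hc)
      unfold Adjacent at this
      omega
    have mF : ∀ c ∈ F, μ c ∈ F := fun c hc => (hF _).2 (hμ.mem ((hF c).1 hc))
    refine Finset.sum_nbij' μ μ ?_ ?_ ?_ ?_ ?_
    · intro c hc
      rw [Finset.mem_filter] at hc ⊢
      have := mp c hc.1
      exact ⟨mF c hc.1, by omega⟩
    · intro c hc
      rw [Finset.mem_filter] at hc ⊢
      have := mp c hc.1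
      exact ⟨mF c hc.1, by omega⟩
    · intro c _; exact hμ.2.1 c
    · intro c _; exact hμ.2.1 c
    · intro c _; rfl
  have htot : ∑ c ∈ F.filter (fun c => (c.1 + c.2) % 2 = 1), (s (μ c) - s c + g c) = 0 := by
    rw [Finset.sum_add_distrib, Finset.sum_sub_distrib, hm0, hs0, hg0]; rfl
  have hnn : ∀ c ∈ F.filter (fun c => (c.1 + c.2) % 2 = 1), 0 ≤ s (μ c) - s c + g c := by
    rintro ⟨a, b⟩ hc
    rw [Finset.mem_filter, hF] at hc
    have h1 := hμ.2.2 _ hc.1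
    by_cases hax : a + b = N
    · obtain rfl : b = N - a := by omega
      by_cases ha : a % 2 = 0
      · have h2 := hup a ha hc.1
        unfold upAt at h2
        simp only [s, g]
        split_ifs <;> omega
      · simp only [s, g]
        split_ifs <;> omega
    · unfold Adjacent at h1
      simp only [s, g] at *
      split_ifs <;> omega
  have hz := (Finset.sum_eq_zero_iff_of_nonneg hnn).1 htot (x, N - x) (by
    rw [Finset.mem_filter, hF]
    exact ⟨hxR, by simp only; omega⟩)
  simp only [s, g] at hz
  split_ifs at hz <;> omega

theorem mem_Hreg_iff (m n : ℕ) (N : ℤ) (hN : N = 2 * n - 1) (c : ℤ × ℤ) :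
    c ∈ Hreg m n ↔ c ∈ holeySquare m n ∧ (c.1 + c.2 < N ∨ c.1 + c.2 = N ∧ c.1 % 2 = 1) := by
  simp only [Hreg, holeySquare, Set.mem_ofPred_eq]
  omega

theorem up_iff (m n : ℕ) (N : ℤ) (hN : N = 2 * n - 1) (μ : ℤ × ℤ → ℤ × ℤ)
    (hμ : IsM (holeySquare m n) μ) :
    (∀ x, x % 2 = 0 → (x, N - x) ∈ holeySquare m n → upAt N μ x) ↔
      ∀ c ∈ Hreg m n, μ c ∈ Hreg m n := by
  constructor
  · rintro h ⟨a, b⟩ hc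
    rw [mem_Hreg_iff m n N hN] at hc ⊢
    refine ⟨hμ.mem hc.1, ?_⟩
    have h1 := hμ.2.2 _ hc.1
    rcases hc.2 with h2 | ⟨h2, h3⟩
    · rcases hd : μ (a, b) with ⟨p, q⟩
      rw [hd] at h1
      simp only [Adjacent] at h1 h2 ⊢
      by_cases h4 : p + q = N
      · obtain rfl : q = N - p := by omega
        by_cases h5 : p % 2 = 0
        · exfalso
          have h6 := h p h5 (by rw [← hd]; exact hμ.mem hc.1)
          unfold upAt at h6
          rw [← hd, hμ.2.1] at h6
          simp only at h6
          omega
        · omega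
      · omega
    · simp only at h2 h3
      obtain rfl : b = N - a := by omega
      exact Or.inl (odd_down m n N hN μ hμ h a h3 hc.1)
  · intro h x hx hxR
    have h1 := hμ.2.2 _ hxR
    unfold upAt
    by_contra hn
    have h2 : μ (x, N - x) ∈ Hreg m n := by
      rw [mem_Hreg_iff m n N hN]
      refine ⟨hμ.mem hxR, ?_⟩
      unfold Adjacent at h1
      omega
    have h3 := h _ h2
    rw [hμ.2.1, mem_Hreg_iff m n N hN] at h3
    simp only at h3
    omega

theorem exists_J (m n : ℕ) (N : ℤ) (hN : N = 2 * n - 1) (hmn : m < n) :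
    ∃ J : Finset ℤ, J.card = n - m ∧
      ∀ x, x ∈ J ↔ x % 2 = 0 ∧ (x, N - x) ∈ holeySquare m n := by
  refine ⟨(Finset.range (n - m)).image
    (fun k : ℕ => if 2 * (k : ℤ) < n - m then 2 * (k : ℤ) else 2 * k + 2 * m), ?_, ?_⟩
  · rw [Finset.card_image_of_injOn, Finset.card_range]
    intro a _ b _ h
    simp only at h
    split_ifs at h <;> omega
  · intro x
    simp only [Finset.mem_image, Finset.mem_range, holeySquare, Set.mem_ofPred_eq]
    constructor
    · rintro ⟨k, hk, h⟩
      split_ifs at h <;> omega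
    · intro h
      by_cases hx : x < n - m
      · refine ⟨(x / 2).toNat, by omega, ?_⟩
        rw [if_pos (by omega)]; omega
      · refine ⟨(x / 2 - m).toNat, by omega, ?_⟩
        rw [if_neg (by omega)]; omega

theorem factor (m n : ℕ) (hmn : m < n) :
    Nat.card (Mat (holeySquare m n)) = 2 ^ (n - m) * (Nat.card (Mat (Hreg m n))) ^ 2 := by
  obtain ⟨N, hN⟩ : ∃ N : ℤ, N = 2 * n - 1 := ⟨_, rfl⟩
  obtain ⟨J, hJc, hJ⟩ := exists_J m n N hN hmn
  have h1 := halving m n N hN hmn J (fun x hx => (hJ x).1 hx)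
  rw [hJc] at h1
  have h2 := card_split (holeySquare m n) (Hreg m n) (holeySquare m n \ Hreg m n)
    (by
      intro c
      have := mem_Hreg_iff m n N hN c
      simp only [Set.mem_sdiff]
      tauto)
    (by intro c hc; simp [hc])
  have h3 : Nat.card (Mat (Hreg m n)) = Nat.card (Mat (holeySquare m n \ Hreg m n)) := by
    refine card_conj _ _ (fun c => (N - c.1, N - c.2)) ?_ ?_ ?_
    · intro c; simp
    · intro c d h; simp only [Adjacent] at *; omega
    · intro c
      simp only [Set.mem_sdiff, mem_Hreg_iff m n N hN, holeySquare, Set.mem_ofPred_eq]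
      omega
  rw [← h3] at h2
  have h4 : Nat.card {μ : Mat (holeySquare m n) // ∀ c ∈ Hreg m n, μ.1 c ∈ Hreg m n}
      = Set.ncard {μ | IsM (holeySquare m n) μ ∧ ∀ x ∈ J, upAt N μ x} := by
    rw [← Nat.card_coe_set_eq]
    refine Nat.card_congr ((Equiv.subtypeSubtypeEquivSubtypeInter _
      (fun μ : ℤ × ℤ → ℤ × ℤ => ∀ c ∈ Hreg m n, μ c ∈ Hreg m n)).trans
      (Equiv.subtypeEquivRight ?_))
    intro μ
    simp only [Set.mem_ofPred_eq]
    refine and_congr_right (fun hμ => ?_)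
    rw [← up_iff m n N hN μ hμ]
    constructor
    · intro h x hx; exact h x ((hJ x).1 hx).1 ((hJ x).1 hx).2
    · intro h x h5 h6; exact h x ((hJ x).2 ⟨h5, h6⟩)
  rw [← h4, h2] at h1
  rw [pow_two, ← h1, ← Nat.card_coe_set_eq]
  rfl


theorem holey_square_factorization (m n : ℕ) (hm : 1 ≤ m) (hmn : m < n) :
    numTilings (holeySquare m n) = 2 ^ (n - m) * (numTilings (Hreg m n)) ^ 2 ∧
    Odd (numTilings (Hreg m n)) ∧
    ∃ k : ℕ, numTilings (holeySquare m n) = 2 ^ (n - m) * (2 * k + 1) ^ 2 := by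
  have h1 := factor m n hmn
  have h2 := odd_Hreg m n hmn
  rw [numTilings_eq, numTilings_eq]
  refine ⟨h1, h2, ?_⟩
  obtain ⟨k, hk⟩ := h2
  exact ⟨k, by rw [h1, hk]⟩
end

section
/- For all integers m ≥ 1 and n > m, there exists a natural number k such that the number of domino tilings of the holey square 𝓗(m,n) equals 2^(n−m) · (2k+1)². -/
namespace HS
open Finset

def sg (a b : ℤ) : ℤˣ := if a < b then 1 else -1

lemma sg_mul_self (a b : ℤ) : sg a b * sg a b = 1 := by
  unfold sg; split_ifs <;> simp

lemma sg_swap {a b : ℤ} (h : a ≠ b) : sg a b = - sg b a := by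
  unfold sg; split_ifs <;> first | omega | simp

lemma pair_prod {p : ℕ} (G : Fin p → Fin p → ℤˣ) :
    ∏ j, ∏ i ∈ Iio j, (G i j * G j i) = ∏ j, ∏ i ∈ univ.erase j, G i j := by
  have h1 : ∏ j, ∏ i ∈ Iio j, G j i = ∏ j, ∏ i ∈ Ioi j, G i j := by
    apply Finset.prod_comm'
    intro x y; simp
  simp_rw [prod_mul_distrib]
  rw [h1, ← prod_mul_distrib]
  apply prod_congr rfl
  intro j _
  rw [← prod_union]
  · apply prod_congr _ (fun _ _ => rfl)
    ext i; simp [lt_or_lt_iff_ne]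
  · rw [Finset.disjoint_left]; intro i; simp; exact fun h => h.le

def cr {p : ℕ} (π : Equiv.Perm (Fin p)) (i j : Fin p) : ℤˣ :=
  (sg (2 * i) (2 * j) * sg (2 * i) (2 * π j + 1)) *
  (sg (2 * π i + 1) (2 * j) * sg (2 * π i + 1) (2 * π j + 1))

lemma prod_sg_le {p : ℕ} (i : Fin p) :
    ∏ j : Fin p, (sg (2 * i) (2 * j) * sg (2 * i) (2 * j + 1)) = -1 := by
  rw [← mul_prod_erase univ _ (mem_univ i)]
  rw [prod_eq_one]
  · simp [sg]
  · intro j hj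
    have : j ≠ i := by simpa using hj
    have : (j : ℕ) ≠ i := fun h => this (Fin.ext h)
    unfold sg; split_ifs <;> first | omega | simp

lemma prod_sg_lt {p : ℕ} (i : Fin p) :
    ∏ j : Fin p, (sg (2 * i + 1) (2 * j) * sg (2 * i + 1) (2 * j + 1)) = 1 := by
  apply prod_eq_one
  intro j hj
  unfold sg; split_ifs <;> first | omega | simp

lemma prod_cr {p : ℕ} (π : Equiv.Perm (Fin p)) (i : Fin p) :
    ∏ j ∈ univ.erase i, cr π i j = 1 := by
  have h1 : ∏ j, cr π i j = -1 := by
    unfold cr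
    simp_rw [prod_mul_distrib]
    rw [Equiv.prod_comp π (fun j : Fin p => sg (2 * i) (2 * j + 1)),
      Equiv.prod_comp π (fun j : Fin p => sg (2 * π i + 1) (2 * j + 1))]
    rw [← prod_mul_distrib, ← prod_mul_distrib, prod_sg_le, prod_sg_lt]; simp
  rw [← mul_prod_erase univ _ (mem_univ i)] at h1
  have h2 : cr π i i = -1 := by
    unfold cr sg; split_ifs <;> first | omega | simp
  rw [h2] at h1
  simpa using h1

lemma cr_symm {p : ℕ} (π : Equiv.Perm (Fin p)) {i j : Fin p} (h : i ≠ j) :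
    cr π i j = cr π j i := by
  have h1 : (j : ℕ) ≠ i := fun h' => h (Fin.ext h').symm
  have h2 : (π j : ℕ) ≠ π i := fun h' => h (π.injective (Fin.ext h')).symm
  unfold cr
  rw [sg_swap (a := 2 * (i : ℤ)) (b := 2 * j) (by omega),
    sg_swap (a := 2 * (i : ℤ)) (b := 2 * π j + 1) (by omega),
    sg_swap (b := 2 * (j : ℤ)) (a := 2 * π i + 1) (by omega),
    sg_swap (b := 2 * (π j : ℤ) + 1) (a := 2 * π i + 1) (by omega)]
  simp only [neg_mul, mul_neg, neg_neg]
  ac_rfl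

lemma all_cr {p : ℕ} (π : Equiv.Perm (Fin p)) (col : Fin p → Prop)
    (h : ∀ i j, i ≠ j → (col i ↔ col j) → cr π i j = 1) :
    ∏ j, ∏ i ∈ Iio j, cr π i j = 1 := by
  classical
  let G : Fin p → Fin p → ℤˣ := fun i j => if col j ∧ ¬ col i then cr π j i else 1
  have h1 : ∏ j, ∏ i ∈ Iio j, cr π i j = ∏ j, ∏ i ∈ Iio j, (G i j * G j i) := by
    apply prod_congr rfl; intro j _
    apply prod_congr rfl; intro i hi
    have hij : i ≠ j := by simp at hi; exact hi.ne
    by_cases ci : col i <;> by_cases cj : col j <;> simp [G, ci, cj]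
    · exact h i j hij (by tauto)
    · exact cr_symm π hij
    · exact h i j hij (by tauto)
  rw [h1, pair_prod]
  apply prod_eq_one
  intro j _
  by_cases cj : col j
  · rw [← prod_cr π j]
    apply prod_congr rfl
    intro i hi
    have hij : i ≠ j := by simpa using hi
    by_cases ci : col i <;> simp [G, ci, cj]
    exact (h j i hij.symm (by tauto)).symm
  · simp [G, cj]

lemma sign_const (p : ℕ) : ∃ c : ℤˣ, ∀ π : Equiv.Perm (Fin p),
    (∏ j, ∏ i ∈ Iio j, cr π i j = 1) →
    Equiv.Perm.sign π * ∏ j, sg (2 * (j : Fin p)) (2 * π j + 1) = c := by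
  refine ⟨(∏ j : Fin p, ∏ i ∈ Iio j, (-1 : ℤˣ)) *
    ∏ k : Fin p, ∏ i : Fin p, sg (2 * i) (2 * k + 1), fun π hπ => ?_⟩
  have h0 : Equiv.Perm.sign π * (∏ j, ∏ i ∈ Iio j, cr π i j) =
      ∏ j : Fin p, ∏ i ∈ Iio j, ((-1) * (sg (2 * i) (2 * π j + 1) * sg (2 * j) (2 * π i + 1))) := by
    rw [Equiv.Perm.sign_eq_prod_prod_Iio, ← prod_mul_distrib]
    apply prod_congr rfl; intro j _
    rw [← prod_mul_distrib]
    apply prod_congr rfl; intro i hi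
    have hij : i < j := by simpa using hi
    have h1 : (i : ℕ) < j := hij
    have h2 : (π j : ℕ) ≠ π i := fun h' => hij.ne (π.injective (Fin.ext h')).symm
    have h3 : π i < π j ↔ (π i : ℕ) < π j := Iff.rfl
    simp only [h3]
    unfold cr sg
    split_ifs <;> first | omega | simp
  rw [hπ, mul_one] at h0
  rw [h0]
  simp_rw [prod_mul_distrib (f := fun _ => (-1 : ℤˣ))]
  rw [prod_mul_distrib, mul_assoc]
  congr 1
  rw [pair_prod (fun i j => sg (2 * i) (2 * π j + 1)), ← prod_mul_distrib]
  rw [← Equiv.prod_comp π (fun k => ∏ i : Fin p, sg (2 * i) (2 * k + 1))]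
  apply prod_congr rfl; intro j _
  rw [prod_erase_mul _ _ (mem_univ j)]
end HS

namespace HS
open Finset

lemma adj_symm {a b : ℤ × ℤ} (h : Adjacent a b) : Adjacent b a := by
  unfold Adjacent at *; omega

abbrev Wh (m n : ℕ) := {c : ℤ × ℤ // c ∈ holeySquare m n ∧ (c.1 + c.2) % 2 = 0}
abbrev Bh (m n : ℕ) := {c : ℤ × ℤ // c ∈ holeySquare m n ∧ (c.1 + c.2) % 2 = 1}

lemma pair_inj {α : Type*} {a b c : α} (h : ({a, b} : Set α) = {a, c}) : b = c := by
  have h1 : b ∈ ({a, c} : Set α) := by rw [← h]; simp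
  have h2 : c ∈ ({a, b} : Set α) := by rw [h]; simp
  simp at h1 h2
  rcases h1 with rfl | h1
  · rcases h2 with h2 | h2 <;> exact h2.symm
  · exact h1

lemma tiling_unique {R : Set (ℤ × ℤ)} {T : Set (Set (ℤ × ℤ))} (hT : IsDominoTiling R T)
    {a b c : ℤ × ℤ} (h1 : {a, b} ∈ T) (h2 : {a, c} ∈ T) : b = c := by
  by_contra hne
  have hne' : ({a, b} : Set (ℤ × ℤ)) ≠ {a, c} := fun h => hne (pair_inj h)
  have := hT.2.1 h1 h2 hne'
  simp only [Function.onFun, id] at this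
  exact Set.disjoint_left.1 this (show a ∈ ({a, b} : Set (ℤ × ℤ)) by simp) (by simp)

lemma tiling_partner {R : Set (ℤ × ℤ)} {T : Set (Set (ℤ × ℤ))} (hT : IsDominoTiling R T)
    {a : ℤ × ℤ} (ha : a ∈ R) : ∃ b ∈ R, Adjacent a b ∧ {a, b} ∈ T := by
  obtain ⟨h1, h2, h3⟩ := hT
  rw [← h3] at ha ⊢
  obtain ⟨d, hd, had⟩ := ha
  obtain ⟨x, y, hxy, rfl⟩ := h1 d hd
  simp at had
  rcases had with rfl | rfl
  · exact ⟨y, ⟨_, hd, by simp⟩, hxy, hd⟩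
  · exact ⟨x, ⟨_, hd, by simp⟩, adj_symm hxy, by rwa [Set.pair_comm]⟩

lemma numTilings_eq (m n : ℕ) : numTilings (holeySquare m n) =
    Nat.card {M : Wh m n ≃ Bh m n // ∀ w, Adjacent w.1 (M w).1} := by
  symm
  unfold numTilings
  let F : {M : Wh m n ≃ Bh m n // ∀ w, Adjacent w.1 (M w).1} →
      {T : Set (Set (ℤ × ℤ)) // IsDominoTiling (holeySquare m n) T} := fun M =>
    ⟨Set.range (fun w : Wh m n => ({w.1, (M.1 w).1} : Set (ℤ × ℤ))), by
      refine ⟨?_, ?_, ?_⟩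
      · rintro d ⟨w, rfl⟩
        exact ⟨_, _, M.2 w, rfl⟩
      · rintro d ⟨w, rfl⟩ d' ⟨w', rfl⟩ hne
        have hww : w ≠ w' := by rintro rfl; exact hne rfl
        have h1 : w.1 ≠ w'.1 := fun h => hww (Subtype.ext h)
        have h2 : (M.1 w).1 ≠ (M.1 w').1 := fun h => hww (M.1.injective (Subtype.ext h))
        have h3 : ∀ (v : Wh m n) (b : Bh m n), v.1 ≠ b.1 := by
          intro v b h
          have := v.2.2; have := b.2.2; rw [h] at *; omega
        simp only [Function.onFun, id]
        rw [Set.disjoint_left]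
        intro c hc hc'
        simp at hc hc'
        rcases hc with rfl | rfl <;> rcases hc' with hc' | hc'
        · exact h1 hc'
        · exact h3 _ _ hc'
        · exact h3 _ _ hc'.symm
        · exact h2 hc'
      · ext c
        constructor
        · rintro ⟨d, ⟨w, rfl⟩, hc⟩
          simp at hc
          rcases hc with rfl | rfl
          · exact w.2.1
          · exact (M.1 w).2.1
        · intro hc
          rcases Int.emod_two_eq_zero_or_one (c.1 + c.2) with h | h
          · exact ⟨_, ⟨⟨c, hc, h⟩, rfl⟩, by simp⟩
          · refine ⟨_, ⟨M.1.symm ⟨c, hc, h⟩, rfl⟩, by simp⟩⟩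
  apply Nat.card_congr
  refine Equiv.ofBijective F ⟨?_, ?_⟩
  · intro M M' h
    have hT := (F M).2
    apply Subtype.ext
    ext1 w
    apply Subtype.ext
    apply tiling_unique hT (a := w.1)
    · exact ⟨w, rfl⟩
    · rw [h]; exact ⟨w, rfl⟩
  · rintro ⟨T, hT⟩
    have hW : ∀ w : Wh m n, ∃ b : Bh m n, Adjacent w.1 b.1 ∧ {w.1, b.1} ∈ T := by
      intro w
      obtain ⟨b, hb, hab, hbT⟩ := tiling_partner hT w.2.1
      refine ⟨⟨b, hb, ?_⟩, hab, hbT⟩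
      have := w.2.2
      unfold Adjacent at hab; omega
    have hB : ∀ b : Bh m n, ∃ w : Wh m n, Adjacent b.1 w.1 ∧ {b.1, w.1} ∈ T := by
      intro w
      obtain ⟨b, hb, hab, hbT⟩ := tiling_partner hT w.2.1
      refine ⟨⟨b, hb, ?_⟩, hab, hbT⟩
      have := w.2.2
      unfold Adjacent at hab; omega
    choose f hf1 hf2 using hW
    choose g hg1 hg2 using hB
    let M : Wh m n ≃ Bh m n := ⟨f, g, fun w => Subtype.ext (tiling_unique hT (hg2 (f w))
      (by rw [Set.pair_comm]; exact hf2 w)), fun b => Subtype.ext (tiling_unique hT (hf2 (g b))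
      (by rw [Set.pair_comm]; exact hg2 b))⟩
    refine ⟨⟨M, hf1⟩, Subtype.ext ?_⟩
    ext d
    constructor
    · rintro ⟨w, rfl⟩
      exact hf2 w
    · intro hd
      obtain ⟨x, y, hxy, rfl⟩ := hT.1 d hd
      have hx : x ∈ holeySquare m n := by rw [← hT.2.2]; exact ⟨_, hd, by simp⟩
      have hy : y ∈ holeySquare m n := by rw [← hT.2.2]; exact ⟨_, hd, by simp⟩
      rcases Int.emod_two_eq_zero_or_one (x.1 + x.2) with h | h
      · refine ⟨⟨x, hx, h⟩, ?_⟩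
        have := tiling_unique hT hd (hf2 ⟨x, hx, h⟩)
        simp only [this]; rfl
      · have h' : (y.1 + y.2) % 2 = 0 := by unfold Adjacent at hxy; omega
        refine ⟨⟨y, hy, h'⟩, ?_⟩
        rw [Set.pair_comm] at hd
        have := tiling_unique hT hd (hf2 ⟨y, hy, h'⟩)
        rw [Set.pair_comm]
        simp only [this]; rfl

def InQ (n : ℕ) (c : ℤ × ℤ) : Prop := 0 ≤ c.1 ∧ c.1 < 2 * n ∧ 0 ≤ c.2 ∧ c.2 < 2 * n

def InO (m n : ℕ) (c : ℤ × ℤ) : Prop :=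
  (n : ℤ) - m ≤ c.1 ∧ c.1 < (n : ℤ) + m ∧ (n : ℤ) - m ≤ c.2 ∧ c.2 < (n : ℤ) + m

lemma mem_H {m n : ℕ} {c : ℤ × ℤ} : c ∈ holeySquare m n ↔ InQ n c ∧ ¬ InO m n c := by
  unfold holeySquare InQ InO; simp only [Set.mem_ofPred_eq]; tauto

abbrev Wo (m n : ℕ) := {c : ℤ × ℤ // InO m n c ∧ (c.1 + c.2) % 2 = 0}
abbrev Bo (m n : ℕ) := {c : ℤ × ℤ // InO m n c ∧ (c.1 + c.2) % 2 = 1}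

lemma finQ (n : ℕ) : {c : ℤ × ℤ | InQ n c}.Finite := by
  apply Set.Finite.subset (Set.finite_Icc ((0, 0) : ℤ × ℤ) (2 * n, 2 * n))
  rintro ⟨x, y⟩ h
  simp only [InQ, Set.mem_ofPred_eq] at h
  simp only [Set.mem_Icc, Prod.mk_le_mk]; omega

@[reducible] noncomputable def ftOf (n : ℕ) (P : ℤ × ℤ → Prop) (h : ∀ c, P c → InQ n c) :
    Fintype {c // P c} := ((finQ n).subset h).fintype

noncomputable instance (m n : ℕ) : Fintype (Wh m n) :=
  ftOf n _ (fun _ h => (mem_H.1 h.1).1)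
noncomputable instance (m n : ℕ) : Fintype (Bh m n) :=
  ftOf n _ (fun _ h => (mem_H.1 h.1).1)

def pos (n : ℕ) (c : ℤ × ℤ) : ℤ :=
  2 * (n * c.2) + if c.2 % 2 = 0 then c.1 else 2 * n - 1 - c.1

lemma pos_mod (n : ℕ) (c : ℤ × ℤ) : pos n c % 2 = (c.1 + c.2) % 2 := by
  unfold pos; split_ifs <;> omega

lemma row_lt {n : ℕ} {y y' : ℤ} (h : y < y') : (n : ℤ) * y + n ≤ n * y' := by nlinarith

lemma pos_inj {n : ℕ} {c c' : ℤ × ℤ} (h : InQ n c) (h' : InQ n c') (e : pos n c = pos n c') :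
    c = c' := by
  obtain ⟨x, y⟩ := c
  obtain ⟨x', y'⟩ := c'
  simp only [InQ, pos] at *
  rcases lt_trichotomy y y' with hy | rfl | hy
  · have := row_lt (n := n) hy
    split_ifs at e <;> omega
  · ext
    · simp only; split_ifs at e <;> omega
    · rfl
  · have := row_lt (n := n) hy
    split_ifs at e <;> omega

lemma pos_range {n : ℕ} {c : ℤ × ℤ} (h : InQ n c) : 0 ≤ pos n c ∧ pos n c < 2 * (2 * n * n) := by
  obtain ⟨x, y⟩ := c
  simp only [InQ, pos] at *
  have h1 : (n : ℤ) * y + n ≤ n * (2 * n) := row_lt h.2.2.2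
  have h2 : 0 ≤ (n : ℤ) * y := mul_nonneg (by omega) h.2.2.1
  have h3 : (n : ℤ) * (2 * n) = 2 * n * n := by ring
  split_ifs <;> omega

lemma pos_surj {n : ℕ} {q : ℤ} (h0 : 0 ≤ q) (h : q < 2 * (2 * n * n)) :
    ∃ c, InQ n c ∧ pos n c = q := by
  have hn : 0 < (n : ℤ) := by
    rcases Nat.eq_zero_or_pos n with rfl | h'
    · simp at h; omega
    · exact_mod_cast h'
  set y := q / (2 * n) with hy
  set t := q % (2 * n) with ht
  have e : 2 * n * y + t = q := Int.mul_ediv_add_emod q (2 * n)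
  have t0 : 0 ≤ t := Int.emod_nonneg _ (by omega)
  have t1 : t < 2 * n := Int.emod_lt_of_pos _ (by omega)
  have y0 : 0 ≤ y := Int.ediv_nonneg h0 (by omega)
  have y1 : y < 2 * n := Int.ediv_lt_of_lt_mul (by omega) (by nlinarith)
  have e' : 2 * (n * y) + t = q := by rw [← e]; ring
  by_cases hp : y % 2 = 0
  · exact ⟨(t, y), by simp only [InQ]; omega, by simp only [pos, hp]; simp; omega⟩
  · exact ⟨(2 * n - 1 - t, y), by simp only [InQ]; omega, by simp only [pos, hp]; simp; omega⟩

end HS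

namespace HS
open Finset

noncomputable instance (m n : ℕ) [h : Fact (m ≤ n)] : Fintype (Wo m n) :=
  ftOf n _ (fun c h' => by have := h.out; have := h'.1; unfold InO at this; unfold InQ; omega)
noncomputable instance (m n : ℕ) [h : Fact (m ≤ n)] : Fintype (Bo m n) :=
  ftOf n _ (fun c h' => by have := h.out; have := h'.1; unfold InO at this; unfold InQ; omega)

lemma nc_near {a b c d : ℤ} (h : b = a + 1 ∨ a = b + 1) (h1 : a ≠ c) (h2 : a ≠ d) (h3 : b ≠ c)
    (h4 : b ≠ d) : sg a c * sg a d * (sg b c * sg b d) = 1 := by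
  have e1 : sg a c = sg b c := by unfold sg; split_ifs <;> first | omega | rfl
  have e2 : sg a d = sg b d := by unfold sg; split_ifs <;> first | omega | rfl
  rw [e1, e2, mul_mul_mul_comm, sg_mul_self, sg_mul_self, one_mul]

lemma nc_near' {a b c d : ℤ} (h : d = c + 1 ∨ c = d + 1) (h1 : a ≠ c) (h2 : a ≠ d) (h3 : b ≠ c)
    (h4 : b ≠ d) : sg a c * sg a d * (sg b c * sg b d) = 1 := by
  have e1 : sg a c = sg a d := by unfold sg; split_ifs <;> first | omega | rfl
  have e2 : sg b c = sg b d := by unfold sg; split_ifs <;> first | omega | rfl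
  rw [e1, e2, sg_mul_self, sg_mul_self, one_mul]

lemma nc_nest {a b c d S : ℤ} (h : a + b = S) (h' : c + d = S) (h1 : a ≠ c) (h2 : a ≠ d) :
    sg a c * sg a d * (sg b c * sg b d) = 1 := by
  unfold sg; split_ifs <;> first | omega | rfl

lemma nc_far {a b c d S : ℤ} (h1 : a < S) (h2 : b < S) (h3 : S ≤ c) (h4 : S ≤ d) :
    sg a c * sg a d * (sg b c * sg b d) = 1 := by
  unfold sg; split_ifs <;> first | omega | rfl

lemma nc_far' {a b c d S : ℤ} (h1 : S ≤ a) (h2 : S ≤ b) (h3 : c < S) (h4 : d < S) :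
    sg a c * sg a d * (sg b c * sg b d) = 1 := by
  unfold sg; split_ifs <;> first | omega | rfl

/-- Lower row of a domino. -/
def lo (a b : ℤ × ℤ) : ℤ := min a.2 b.2

lemma pos_bounds {n : ℕ} {c : ℤ × ℤ} (h : InQ n c) :
    2 * (n * c.2) ≤ pos n c ∧ pos n c < 2 * (n * c.2) + 2 * n := by
  unfold pos InQ at *; split_ifs <;> omega

lemma arc {n : ℕ} {a b : ℤ × ℤ} (ha : InQ n a) (hb : InQ n b) (hab : Adjacent a b) :
    (pos n b = pos n a + 1 ∨ pos n a = pos n b + 1) ∨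
    (pos n a + pos n b = 4 * (n * lo a b) + 4 * n - 1 ∧
      2 * (n * lo a b) ≤ pos n a ∧ 2 * (n * lo a b) ≤ pos n b ∧
      pos n a < 2 * (n * lo a b) + 4 * n ∧ pos n b < 2 * (n * lo a b) + 4 * n) := by
  obtain ⟨x, y⟩ := a
  obtain ⟨x', y'⟩ := b
  simp only [Adjacent] at hab
  rcases hab with ⟨rfl, h | h⟩ | ⟨rfl, h⟩
  · right
    subst h
    have e1 : lo (x, y' + 1) (x, y') = y' := by unfold lo; simp
    have e2 : (n : ℤ) * (y' + 1) = n * y' + n := by ring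
    rw [e1]
    simp only [pos, InQ] at *
    rw [e2]
    split_ifs <;> omega
  · right
    subst h
    have e1 : lo (x, y) (x, y + 1) = y := by unfold lo; simp
    have e2 : (n : ℤ) * (y + 1) = n * y + n := by ring
    rw [e1]
    simp only [pos, InQ] at *
    rw [e2]
    split_ifs <;> omega
  · left
    simp only [pos]
    split_ifs <;> omega

lemma noncross {n : ℕ} {a b c d : ℤ × ℤ} (ha : InQ n a) (hb : InQ n b) (hc : InQ n c)
    (hd : InQ n d) (hab : Adjacent a b) (hcd : Adjacent c d) (h1 : a ≠ c) (h2 : a ≠ d)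
    (h3 : b ≠ c) (h4 : b ≠ d) (hcol : lo a b % 2 = 0 ↔ lo c d % 2 = 0) :
    sg (pos n a) (pos n c) * sg (pos n a) (pos n d) *
      (sg (pos n b) (pos n c) * sg (pos n b) (pos n d)) = 1 := by
  have g1 : pos n a ≠ pos n c := fun h => h1 (pos_inj ha hc h)
  have g2 : pos n a ≠ pos n d := fun h => h2 (pos_inj ha hd h)
  have g3 : pos n b ≠ pos n c := fun h => h3 (pos_inj hb hc h)
  have g4 : pos n b ≠ pos n d := fun h => h4 (pos_inj hb hd h)
  rcases arc ha hb hab with h | ⟨s1, l1, l2, l3, l4⟩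
  · exact nc_near h g1 g2 g3 g4
  rcases arc hc hd hcd with h | ⟨s2, k1, k2, k3, k4⟩
  · exact nc_near' h g1 g2 g3 g4
  rcases lt_trichotomy (lo a b) (lo c d) with hy | hy | hy
  · have : lo a b + 1 < lo c d := by omega
    have := row_lt (n := n) this
    have e : (n : ℤ) * (lo a b + 1) = n * lo a b + n := by ring
    exact nc_far (S := 2 * (n * lo c d)) (by omega) (by omega) k1 k2
  · rw [hy] at s1
    exact nc_nest s1 s2 g1 g2
  · have : lo c d + 1 < lo a b := by omega
    have := row_lt (n := n) this
    have e : (n : ℤ) * (lo c d + 1) = n * lo c d + n := by ring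
    exact nc_far' (S := 2 * (n * lo a b)) l1 l2 (by omega) (by omega)

def cellW {m n : ℕ} : Wh m n ⊕ Wo m n → ℤ × ℤ := Sum.elim (fun c => c.1) (fun c => c.1)
def cellB {m n : ℕ} : Bh m n ⊕ Bo m n → ℤ × ℤ := Sum.elim (fun c => c.1) (fun c => c.1)

lemma O_sub_Q {m n : ℕ} (h : m ≤ n) {c : ℤ × ℤ} (hc : InO m n c) : InQ n c := by
  unfold InO InQ at *; omega

lemma cellW_prop {m n : ℕ} (h : m ≤ n) (s : Wh m n ⊕ Wo m n) :
    InQ n (cellW s) ∧ pos n (cellW s) % 2 = 0 := by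
  rw [pos_mod]
  rcases s with s | s
  · exact ⟨(mem_H.1 s.2.1).1, s.2.2⟩
  · exact ⟨O_sub_Q h s.2.1, s.2.2⟩

lemma cellB_prop {m n : ℕ} (h : m ≤ n) (s : Bh m n ⊕ Bo m n) :
    InQ n (cellB s) ∧ pos n (cellB s) % 2 = 1 := by
  rw [pos_mod]
  rcases s with s | s
  · exact ⟨(mem_H.1 s.2.1).1, s.2.2⟩
  · exact ⟨O_sub_Q h s.2.1, s.2.2⟩

lemma cellW_inj {m n : ℕ} : Function.Injective (cellW (m := m) (n := n)) := by
  rintro (a | a) (b | b) h <;> simp only [cellW, Sum.elim_inl, Sum.elim_inr] at h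
  · rw [Subtype.ext h]
  · exact absurd b.2.1 (h ▸ (mem_H.1 a.2.1).2)
  · exact absurd a.2.1 (h ▸ (mem_H.1 b.2.1).2)
  · rw [Subtype.ext h]

lemma cellB_inj {m n : ℕ} : Function.Injective (cellB (m := m) (n := n)) := by
  rintro (a | a) (b | b) h <;> simp only [cellB, Sum.elim_inl, Sum.elim_inr] at h
  · rw [Subtype.ext h]
  · exact absurd b.2.1 (h ▸ (mem_H.1 a.2.1).2)
  · exact absurd a.2.1 (h ▸ (mem_H.1 b.2.1).2)
  · rw [Subtype.ext h]

lemma exists_wE {m n : ℕ} (h : m ≤ n) :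
    ∃ E : Wh m n ⊕ Wo m n ≃ Fin (2 * n * n), ∀ s, 2 * ((E s : ℕ) : ℤ) = pos n (cellW s) := by
  have hr := fun s : Wh m n ⊕ Wo m n => pos_range (cellW_prop h s).1
  have key : ∀ s : Wh m n ⊕ Wo m n, ∃ k : Fin (2 * n * n), 2 * ((k : ℕ) : ℤ) = pos n (cellW s) := by
    intro s
    have h1 := hr s
    have h2 := (cellW_prop h s).2
    have e : ((2 * n * n : ℕ) : ℤ) = 2 * n * n := by push_cast; ring
    exact ⟨⟨(pos n (cellW s) / 2).toNat, by omega⟩, by simp only; omega⟩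
  choose f hf using key
  refine ⟨Equiv.ofBijective f ⟨?_, ?_⟩, hf⟩
  · intro s t hst
    apply cellW_inj
    apply pos_inj (cellW_prop h s).1 (cellW_prop h t).1
    rw [← hf, ← hf, hst]
  · intro k
    have e : ((2 * n * n : ℕ) : ℤ) = 2 * n * n := by push_cast; ring
    obtain ⟨c, hc, hk⟩ := pos_surj (n := n) (q := 2 * (k : ℕ)) (by omega) (by have := k.2; omega)
    have hm := pos_mod n c
    by_cases ho : InO m n c
    · refine ⟨Sum.inr ⟨c, ho, by omega⟩, Fin.ext ?_⟩
      have := hf (Sum.inr ⟨c, ho, by omega⟩)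
      simp only [cellW, Sum.elim_inr] at this; omega
    · refine ⟨Sum.inl ⟨c, mem_H.2 ⟨hc, ho⟩, by omega⟩, Fin.ext ?_⟩
      have := hf (Sum.inl ⟨c, mem_H.2 ⟨hc, ho⟩, by omega⟩)
      simp only [cellW, Sum.elim_inl] at this; omega

lemma exists_bE {m n : ℕ} (h : m ≤ n) :
    ∃ E : Bh m n ⊕ Bo m n ≃ Fin (2 * n * n), ∀ s, 2 * ((E s : ℕ) : ℤ) + 1 = pos n (cellB s) := by
  have hr := fun s : Bh m n ⊕ Bo m n => pos_range (cellB_prop h s).1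
  have key : ∀ s : Bh m n ⊕ Bo m n,
      ∃ k : Fin (2 * n * n), 2 * ((k : ℕ) : ℤ) + 1 = pos n (cellB s) := by
    intro s
    have h1 := hr s
    have h2 := (cellB_prop h s).2
    have e : ((2 * n * n : ℕ) : ℤ) = 2 * n * n := by push_cast; ring
    exact ⟨⟨(pos n (cellB s) / 2).toNat, by omega⟩, by simp only; omega⟩
  choose f hf using key
  refine ⟨Equiv.ofBijective f ⟨?_, ?_⟩, hf⟩
  · intro s t hst
    apply cellB_inj
    apply pos_inj (cellB_prop h s).1 (cellB_prop h t).1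
    rw [← hf, ← hf, hst]
  · intro k
    have e : ((2 * n * n : ℕ) : ℤ) = 2 * n * n := by push_cast; ring
    obtain ⟨c, hc, hk⟩ := pos_surj (n := n) (q := 2 * (k : ℕ) + 1) (by omega)
      (by have := k.2; omega)
    have hm := pos_mod n c
    by_cases ho : InO m n c
    · refine ⟨Sum.inr ⟨c, ho, by omega⟩, Fin.ext ?_⟩
      have := hf (Sum.inr ⟨c, ho, by omega⟩)
      simp only [cellB, Sum.elim_inr] at this; omega
    · refine ⟨Sum.inl ⟨c, mem_H.2 ⟨hc, ho⟩, by omega⟩, Fin.ext ?_⟩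
      have := hf (Sum.inl ⟨c, mem_H.2 ⟨hc, ho⟩, by omega⟩)
      simp only [cellB, Sum.elim_inl] at this; omega

def hp (m n : ℕ) (c : ℤ × ℤ) : ℤ × ℤ :=
  if (c.1 - (n - m)) % 2 = 0 then (c.1 + 1, c.2) else (c.1 - 1, c.2)

lemma hp_hp (m n : ℕ) (c : ℤ × ℤ) : hp m n (hp m n c) = c := by
  unfold hp; split_ifs <;> first | omega | (ext <;> simp)

lemma hp_O {m n : ℕ} {c : ℤ × ℤ} (h : InO m n c) : InO m n (hp m n c) := by
  unfold hp InO at *; split_ifs <;> simp only <;> omega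

lemma hp_par (m n : ℕ) (c : ℤ × ℤ) :
    ((hp m n c).1 + (hp m n c).2) % 2 = 1 - (c.1 + c.2) % 2 := by
  unfold hp; split_ifs <;> simp only <;> omega

lemma hp_adj (m n : ℕ) (c : ℤ × ℤ) : Adjacent c (hp m n c) := by
  unfold hp Adjacent; split_ifs <;> simp

def holeM (m n : ℕ) : Wo m n ≃ Bo m n where
  toFun c := ⟨hp m n c.1, hp_O c.2.1, by rw [hp_par, c.2.2]; rfl⟩
  invFun c := ⟨hp m n c.1, hp_O c.2.1, by rw [hp_par, c.2.2]; rfl⟩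
  left_inv c := Subtype.ext (hp_hp m n c.1)
  right_inv c := Subtype.ext (hp_hp m n c.1)

lemma kast {m n : ℕ} (h : m ≤ n) (e0 : Wh m n ≃ Bh m n) :
    ∃ c : ℤˣ, ∀ M : Wh m n ≃ Bh m n, (∀ w, Adjacent w.1 (M w).1) →
      Equiv.Perm.sign (M.trans e0.symm) * ∏ w, sg (pos n w.1) (pos n (M w).1) = c := by
  classical
  have : Fact (m ≤ n) := ⟨h⟩
  obtain ⟨wE, hwE⟩ := exists_wE h
  obtain ⟨bE, hbE⟩ := exists_bE h
  obtain ⟨c0, hc0⟩ := sign_const (2 * n * n)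
  let P : (Wh m n ≃ Bh m n) → Equiv.Perm (Fin (2 * n * n)) := fun M =>
    wE.symm.trans ((Equiv.sumCongr M (holeM m n)).trans bE)
  refine ⟨c0 * (Equiv.Perm.sign (P e0) *
    ∏ w : Wo m n, sg (pos n w.1) (pos n (holeM m n w).1)), fun M hM => ?_⟩
  have hadj : ∀ s, Adjacent (cellW s) (cellB (Equiv.sumCongr M (holeM m n) s)) := by
    rintro (s | s)
    · exact hM s
    · exact hp_adj m n s.1
  have hP : ∀ i, 2 * ((P M i : ℕ) : ℤ) + 1 =
      pos n (cellB (Equiv.sumCongr M (holeM m n) (wE.symm i))) := by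
    intro i; rw [← hbE]; rfl
  have hW : ∀ i : Fin (2 * n * n), 2 * ((i : ℕ) : ℤ) = pos n (cellW (wE.symm i)) := by
    intro i; rw [← hwE]; simp
  have hcr : ∏ j, ∏ i ∈ Iio j, cr (P M) i j = 1 := by
    apply all_cr _ (fun i => lo (cellW (wE.symm i))
      (cellB (Equiv.sumCongr M (holeM m n) (wE.symm i))) % 2 = 0)
    intro i j hij hcol
    unfold cr
    rw [hP, hP, hW, hW]
    have q1 := cellW_prop h (wE.symm i)
    have q2 := cellW_prop h (wE.symm j)
    have q3 := cellB_prop h (Equiv.sumCongr M (holeM m n) (wE.symm i))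
    have q4 := cellB_prop h (Equiv.sumCongr M (holeM m n) (wE.symm j))
    apply noncross q1.1 q3.1 q2.1 q4.1 (hadj _) (hadj _) _ _ _ _ hcol
    · intro he; exact hij (wE.symm.injective (cellW_inj he))
    · intro he; rw [he] at q1; omega
    · intro he; rw [he] at q3; omega
    · intro he
      exact hij (wE.symm.injective ((Equiv.sumCongr M (holeM m n)).injective (cellB_inj he)))
  have hmain := hc0 (P M) hcr
  have hsign : Equiv.Perm.sign (P M) =
      Equiv.Perm.sign (M.trans e0.symm) * Equiv.Perm.sign (P e0) := by
    have : P M = wE.symm.trans ((Equiv.Perm.sumCongr (M.trans e0.symm) 1).trans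
        ((Equiv.sumCongr e0 (holeM m n)).trans bE)) := by
      ext i
      simp only [P, Equiv.trans_apply]
      congr 2
      rcases wE.symm i with s | s <;> simp
    rw [this, Equiv.Perm.sign_trans_trans, Equiv.Perm.sign_sumCongr]
    simp [P]
  have hprod : ∏ j : Fin (2 * n * n), sg (2 * ((j : ℕ) : ℤ)) (2 * ((P M j : ℕ) : ℤ) + 1) =
      (∏ w, sg (pos n w.1) (pos n (M w).1)) *
      ∏ w : Wo m n, sg (pos n w.1) (pos n (holeM m n w).1) := by
    simp_rw [hP, hW]
    rw [Equiv.prod_comp wE.symm (fun s => sg (pos n (cellW s))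
      (pos n (cellB (Equiv.sumCongr M (holeM m n) s)))), Fintype.prod_sum_type]
    rfl
  rw [hsign, hprod] at hmain
  rw [← hmain]
  have sq : ∀ u : ℤˣ, u * u = 1 := Int.units_mul_self
  generalize Equiv.Perm.sign (P e0) = u
  generalize ∏ w : Wo m n, sg (pos n w.1) (pos n (holeM m n w).1) = v
  generalize Equiv.Perm.sign (M.trans e0.symm) = a
  generalize ∏ w, sg (pos n w.1) (pos n (M w).1) = b
  calc a * b = a * b * ((u * u) * (v * v)) := by rw [sq, sq]; simp
    _ = _ := by ac_rfl

/-- Signed biadjacency weight. -/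
noncomputable def kw (n : ℕ) (w b : ℤ × ℤ) : ℤ :=
  open Classical in if Adjacent w b then ((sg (pos n w) (pos n b) : ℤˣ) : ℤ) else 0

lemma det_count {m n : ℕ} (h : m ≤ n) (e0 : Wh m n ≃ Bh m n) :
    (numTilings (holeySquare m n) : ℤ) =
      |(Matrix.of fun w w' : Wh m n => kw n w.1 (e0 w').1).det| := by
  classical
  obtain ⟨c, hc⟩ := kast h e0
  have h1 : (Matrix.of fun w w' : Wh m n => kw n w.1 (e0 w').1).det =
      c * (numTilings (holeySquare m n) : ℤ) := by
    rw [← Matrix.det_transpose, Matrix.det_apply', numTilings_eq]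
    have e : {M : Wh m n ≃ Bh m n // ∀ w, Adjacent w.1 (M w).1} ≃
        {σ : Equiv.Perm (Wh m n) // ∀ w, Adjacent w.1 (e0 (σ w)).1} :=
      { toFun := fun M => ⟨M.1.trans e0.symm, fun w => by simpa using M.2 w⟩
        invFun := fun σ => ⟨σ.1.trans e0, fun w => σ.2 w⟩
        left_inv := fun M => Subtype.ext (by ext1; simp)
        right_inv := fun σ => Subtype.ext (by ext1; simp) }
    rw [Nat.card_congr e, Nat.card_eq_fintype_card, Fintype.card_subtype]
    rw [Finset.card_eq_sum_ones, Finset.sum_filter]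
    push_cast
    rw [Finset.mul_sum]
    apply Finset.sum_congr rfl
    intro σ _
    simp only [Matrix.transpose_apply, Matrix.of_apply]
    split_ifs with hσ
    · have := hc (σ.trans e0) hσ
      have e1 : (σ.trans e0).trans e0.symm = σ := by ext1; simp
      rw [e1] at this
      rw [← this]
      push_cast
      rw [mul_one]
      congr 1
      · apply Finset.prod_congr rfl
        intro w _
        rw [kw, if_pos (hσ w)]; rfl
    · push Not at hσ
      obtain ⟨w, hw⟩ := hσ
      rw [Finset.prod_eq_zero (Finset.mem_univ w) (by rw [kw, if_neg hw])]
      simp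
  rw [h1, abs_mul]
  rcases Int.units_eq_one_or c with rfl | rfl <;> simp
end HS

namespace HS
open Matrix

lemma block_det {a d o b : Type*} [Fintype a] [Fintype d] [Fintype o] [Fintype b]
    [DecidableEq a] [DecidableEq d] [DecidableEq o] [DecidableEq b]
    (P : Matrix a b ℤ) (Re : Matrix d b ℤ) (Ro : Matrix o b ℤ) (s : a → ℤ) (g : b → ℤ)
    (hs : ∀ i, s i = 1 ∨ s i = -1) (hg : ∀ i, g i = 1 ∨ g i = -1)
    (ε : a ⊕ d ≃ b) (ε' : a ⊕ o ≃ b) :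
    |((fromBlocks (fromRows P Re) (fromRows 0 (Re * diagonal g)) (fromRows 0 Ro)
      (fromRows (diagonal s * P * diagonal g) (-(Ro * diagonal g)))).submatrix id
        (Equiv.sumCongr ε ε')).det| =
    2 ^ Fintype.card d * |((fromRows P Re).submatrix id ε).det| *
      |((fromRows P Ro).submatrix id ε').det| := by
  have hgg : diagonal g * diagonal g = (1 : Matrix b b ℤ) := by
    rw [diagonal_mul_diagonal, ← diagonal_one]
    congr 1; ext i; rcases hg i with h | h <;> simp [h]
  set X := fromBlocks (fromRows P Re) (fromRows 0 (Re * diagonal g)) (fromRows 0 Ro)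
      (fromRows (diagonal s * P * diagonal g) (-(Ro * diagonal g))) with hX
  set φ := Equiv.sumCongr ε ε' with hφ
  let L : Matrix ((a ⊕ d) ⊕ (a ⊕ o)) ((a ⊕ d) ⊕ (a ⊕ o)) ℤ :=
    fromBlocks 1 0 (fromBlocks (-diagonal s) 0 0 0) 1
  let R : Matrix (b ⊕ b) (b ⊕ b) ℤ := fromBlocks 1 0 (diagonal g) 1
  let D2 : Matrix (a ⊕ d) (a ⊕ d) ℤ := diagonal (Sum.elim (fun _ => 1) (fun _ => 2))
  let Ds : Matrix (a ⊕ o) (a ⊕ o) ℤ := diagonal (Sum.elim s (fun _ => -1))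
  have hL : L.det = 1 := by simp [L]
  have hR : R.det = 1 := by simp [R]
  have hLXR : L * X * R = fromBlocks (D2 * fromRows P Re)
      (fromRows 0 (Re * diagonal g)) 0
      (Ds * fromRows P Ro * diagonal g) := by
    have e1 : D2 * fromRows P Re = fromRows P (Re + Re) := by
      ext (i | i) j <;> simp [two_mul, D2]
    have e2 : Ds * fromRows P Ro * diagonal g =
        fromRows (diagonal s * P * diagonal g) (-(Ro * diagonal g)) := by
      ext (i | i) j <;> simp [Ds]
    have e3 : diagonal s * P * diagonal g * diagonal g = diagonal s * P := by
      rw [Matrix.mul_assoc, hgg, Matrix.mul_one]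
    have e4 : Re * diagonal g * diagonal g = Re := by
      rw [Matrix.mul_assoc, hgg, Matrix.mul_one]
    have e5 : Ro * diagonal g * diagonal g = Ro := by
      rw [Matrix.mul_assoc, hgg, Matrix.mul_one]
    rw [e1, e2, hX]
    simp only [L, R, fromBlocks_multiply, fromBlocks_mul_fromRows, fromRows_mul, Matrix.one_mul,
      Matrix.zero_mul, Matrix.mul_zero, Matrix.mul_one, add_zero, zero_add, e4,
      Matrix.neg_mul]
    congr 1
    all_goals
      ext (i | i) j <;> rcases hg j with h | h <;> simp [h]
  have h1 : (L * X * R).submatrix id φ = L * X.submatrix id φ * R.submatrix φ φ := by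
    rw [← Matrix.submatrix_mul_equiv (L * X) R id φ φ, ← Matrix.submatrix_mul_equiv L X id (Equiv.refl _) φ]
    rfl
  have h2 : (X.submatrix id φ).det = ((L * X * R).submatrix id φ).det := by
    rw [h1, det_mul, det_mul, hL, det_submatrix_equiv_self, hR]; simp
  rw [h2, hLXR]
  have h3 : (fromBlocks (D2 * fromRows P Re)
      (fromRows 0 (Re * diagonal g)) 0
      (Ds * fromRows P Ro * diagonal g)).submatrix id φ =
      fromBlocks (D2 * (fromRows P Re).submatrix id ε)
      ((fromRows 0 (Re * diagonal g)).submatrix id ε') 0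
      (Ds * (fromRows P Ro).submatrix id ε' *
        diagonal (fun i => g (ε' i))) := by
    ext (i | i) (j | j) <;> simp [hφ, D2, Ds]
  rw [h3, det_fromBlocks_zero₂₁, det_mul, det_mul, det_mul, det_diagonal, det_diagonal,
    det_diagonal]
  have h4 : |∏ i, g (ε' i)| = 1 := by
    rw [Finset.abs_prod]
    apply Finset.prod_eq_one; intro i _
    rcases hg (ε' i) with h | h <;> simp [h]
  have h5 : |∏ i, Sum.elim s (fun _ : o => (-1 : ℤ)) i| = 1 := by
    rw [Finset.abs_prod]
    apply Finset.prod_eq_one; rintro (i | i) _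
    · rcases hs i with h | h <;> simp [h]
    · simp
  rw [abs_mul, abs_mul, abs_mul, abs_mul, h4, h5]
  simp
end HS

namespace HS
open Matrix

lemma kwR {n : ℕ} (x y : ℤ) : kw n (x, y) (x + 1, y) = if y % 2 = 0 then 1 else -1 := by
  rw [kw, if_pos (by unfold Adjacent; simp)]
  simp only [sg, pos]
  split_ifs <;> first | rfl | omega

lemma kwL {n : ℕ} (x y : ℤ) : kw n (x, y) (x - 1, y) = if y % 2 = 0 then -1 else 1 := by
  rw [kw, if_pos (by unfold Adjacent; simp)]
  simp only [sg, pos]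
  split_ifs <;> first | rfl | omega

lemma kwU {n : ℕ} {x : ℤ} (y : ℤ) (h0 : 0 ≤ x) (h1 : x < 2 * n) : kw n (x, y) (x, y + 1) = 1 := by
  rw [kw, if_pos (by unfold Adjacent; simp)]
  have := row_lt (n := n) (y := y) (y' := y + 1) (by omega)
  simp only [sg, pos]
  split_ifs <;> first | rfl | omega

lemma kwD {n : ℕ} {x : ℤ} (y : ℤ) (h0 : 0 ≤ x) (h1 : x < 2 * n) : kw n (x, y) (x, y - 1) = -1 := by
  rw [kw, if_pos (by unfold Adjacent; simp)]
  have := row_lt (n := n) (y := y - 1) (y' := y) (by omega)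
  simp only [sg, pos]
  split_ifs <;> first | rfl | omega

lemma kw0 {n : ℕ} {w b : ℤ × ℤ} (h : ¬ Adjacent w b) : kw n w b = 0 := by
  rw [kw, if_neg h]

lemma adj_cases {x y : ℤ} {b : ℤ × ℤ} (h : Adjacent (x, y) b) :
    b = (x + 1, y) ∨ b = (x - 1, y) ∨ b = (x, y + 1) ∨ b = (x, y - 1) := by
  obtain ⟨u, v⟩ := b
  unfold Adjacent at h
  simp only [Prod.mk.injEq] at *
  omega

def gS (c : ℤ × ℤ) : ℤ := if c.1 % 2 = 1 ∧ c.2 % 2 = 1 then -1 else 1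
def hS (c : ℤ × ℤ) : ℤ := if c.1 % 2 = 1 ∧ c.2 % 2 = 0 then -1 else 1
def rho (n : ℕ) (c : ℤ × ℤ) : ℤ × ℤ := (2 * n - 1 - c.2, 2 * n - 1 - c.1)

lemma gS_cases (c) : gS c = 1 ∨ gS c = -1 := by unfold gS; split_ifs <;> simp
lemma hS_cases (c) : hS c = 1 ∨ hS c = -1 := by unfold hS; split_ifs <;> simp

lemma kw_swap {n : ℕ} {w b : ℤ × ℤ} (hw : InQ n w) :
    kw n w.swap b.swap = gS w * gS b * kw n w b := by
  obtain ⟨x, y⟩ := w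
  obtain ⟨h0, h1, h2, h3⟩ := hw
  by_cases h : Adjacent (x, y) b
  · rcases adj_cases h with rfl | rfl | rfl | rfl <;> simp only [Prod.swap_prod_mk, gS] at *
    · rw [kwR, kwU _ h2 h3]; split_ifs <;> first | rfl | omega
    · rw [kwL, kwD _ h2 h3]; split_ifs <;> first | rfl | omega
    · rw [kwR, kwU _ h0 h1]; split_ifs <;> first | rfl | omega
    · rw [kwL, kwD _ h0 h1]; split_ifs <;> first | rfl | omega
  · rw [kw0 h, kw0, mul_zero]
    obtain ⟨u, v⟩ := b
    unfold Adjacent at *; simp only [Prod.swap_prod_mk] at *; omega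

lemma kw_rho {n : ℕ} {w b : ℤ × ℤ} (hw : InQ n w) :
    kw n (rho n w) (rho n b) = hS w * hS b * kw n w b := by
  obtain ⟨x, y⟩ := w
  obtain ⟨h0, h1, h2, h3⟩ := hw
  by_cases h : Adjacent (x, y) b
  · rcases adj_cases h with rfl | rfl | rfl | rfl <;> simp only [rho, hS] at *
    · rw [kwR, show (2 * n - 1 - (x + 1) : ℤ) = 2 * n - 1 - x - 1 by ring, kwD _ (by omega) (by omega)]
      split_ifs <;> first | rfl | omega
    · rw [kwL, show (2 * n - 1 - (x - 1) : ℤ) = 2 * n - 1 - x + 1 by ring, kwU _ (by omega) (by omega)]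
      split_ifs <;> first | rfl | omega
    · rw [kwU _ h0 h1, show (2 * n - 1 - (y + 1) : ℤ) = 2 * n - 1 - y - 1 by ring, kwL]
      split_ifs <;> first | rfl | omega
    · rw [kwD _ h0 h1, show (2 * n - 1 - (y - 1) : ℤ) = 2 * n - 1 - y + 1 by ring, kwR]
      split_ifs <;> first | rfl | omega
  · rw [kw0 h, kw0, mul_zero]
    obtain ⟨u, v⟩ := b
    unfold Adjacent at *; simp only [rho] at *; omega

abbrev Wu (m n : ℕ) := {c : ℤ × ℤ // c ∈ holeySquare m n ∧ (c.1 + c.2) % 2 = 0 ∧ c.1 < c.2}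
abbrev Bu (m n : ℕ) := {c : ℤ × ℤ // c ∈ holeySquare m n ∧ (c.1 + c.2) % 2 = 1 ∧ c.1 < c.2}
abbrev De (m n : ℕ) := {c : ℤ × ℤ // c ∈ holeySquare m n ∧ c.1 % 2 = 0 ∧ c.1 = c.2}
abbrev Do (m n : ℕ) := {c : ℤ × ℤ // c ∈ holeySquare m n ∧ c.1 % 2 = 1 ∧ c.1 = c.2}

noncomputable instance (m n : ℕ) : Fintype (Wu m n) := ftOf n _ (fun _ h => (mem_H.1 h.1).1)
noncomputable instance (m n : ℕ) : Fintype (Bu m n) := ftOf n _ (fun _ h => (mem_H.1 h.1).1)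
noncomputable instance (m n : ℕ) : Fintype (De m n) := ftOf n _ (fun _ h => (mem_H.1 h.1).1)
noncomputable instance (m n : ℕ) : Fintype (Do m n) := ftOf n _ (fun _ h => (mem_H.1 h.1).1)

lemma swap_H {m n : ℕ} {c : ℤ × ℤ} (h : c ∈ holeySquare m n) : c.swap ∈ holeySquare m n := by
  rw [mem_H] at *; unfold InQ InO at *; simp only [Prod.fst_swap, Prod.snd_swap]; omega

lemma rho_H {m n : ℕ} {c : ℤ × ℤ} (h : c ∈ holeySquare m n) : rho n c ∈ holeySquare m n := by
  rw [mem_H] at *; unfold InQ InO rho at *; simp only; omega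

lemma rho_rho (n : ℕ) (c : ℤ × ℤ) : rho n (rho n c) = c := by
  obtain ⟨x, y⟩ := c; simp only [rho, Prod.mk.injEq]; omega

/-- rows -/
def fW (m n : ℕ) : (Wu m n ⊕ De m n) ⊕ (Wu m n ⊕ Do m n) → Wh m n
  | .inl (.inl w) => ⟨w.1, w.2.1, w.2.2.1⟩
  | .inl (.inr w) => ⟨w.1, w.2.1, by have := w.2.2; omega⟩
  | .inr (.inl w) => ⟨w.1.swap, swap_H w.2.1, by
      have := w.2.2; simp only [Prod.fst_swap, Prod.snd_swap]; omega⟩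
  | .inr (.inr w) => ⟨w.1, w.2.1, by have := w.2.2; omega⟩

lemma fW_bij (m n : ℕ) : Function.Bijective (fW m n) := by
  constructor
  · rintro ((⟨⟨x, y⟩, ha⟩ | ⟨⟨x, y⟩, ha⟩) | (⟨⟨x, y⟩, ha⟩ | ⟨⟨x, y⟩, ha⟩))
      ((⟨⟨u, v⟩, hb⟩ | ⟨⟨u, v⟩, hb⟩) | (⟨⟨u, v⟩, hb⟩ | ⟨⟨u, v⟩, hb⟩)) h <;>
    simp only [fW, Subtype.mk.injEq, Prod.swap_prod_mk, Prod.mk.injEq] at h <;>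
    simp only at ha hb <;>
    first
      | (exfalso; omega)
      | (obtain ⟨rfl, rfl⟩ := h; rfl)
  · rintro ⟨⟨x, y⟩, h1, h2⟩
    simp only at h2
    rcases lt_trichotomy x y with h | h | h
    · exact ⟨.inl (.inl ⟨(x, y), h1, h2, h⟩), rfl⟩
    · rcases Int.emod_two_eq_zero_or_one x with h' | h'
      · exact ⟨.inl (.inr ⟨(x, y), h1, h', h⟩), rfl⟩
      · exact ⟨.inr (.inr ⟨(x, y), h1, h', h⟩), rfl⟩
    · exact ⟨.inr (.inl ⟨(y, x), swap_H h1, by simp only; omega, h⟩), rfl⟩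

/-- columns -/
def fB (m n : ℕ) : Bu m n ⊕ Bu m n → Bh m n
  | .inl w => ⟨w.1, w.2.1, w.2.2.1⟩
  | .inr w => ⟨w.1.swap, swap_H w.2.1, by
      have := w.2.2; simp only [Prod.fst_swap, Prod.snd_swap]; omega⟩

lemma fB_bij (m n : ℕ) : Function.Bijective (fB m n) := by
  constructor
  · rintro (⟨⟨x, y⟩, ha⟩ | ⟨⟨x, y⟩, ha⟩) (⟨⟨u, v⟩, hb⟩ | ⟨⟨u, v⟩, hb⟩) h <;>
    simp only [fB, Subtype.mk.injEq, Prod.swap_prod_mk, Prod.mk.injEq] at h <;>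
    simp only at ha hb <;>
    first
      | (exfalso; omega)
      | (obtain ⟨rfl, rfl⟩ := h; rfl)
  · rintro ⟨⟨x, y⟩, h1, h2⟩
    simp only at h2
    rcases lt_trichotomy x y with h | h | h
    · exact ⟨.inl ⟨(x, y), h1, h2, h⟩, rfl⟩
    · omega
    · exact ⟨.inr ⟨(y, x), swap_H h1, by simp only; omega, h⟩, rfl⟩

def rhoW (m n : ℕ) : Wu m n ≃ Wu m n where
  toFun w := ⟨rho n w.1, rho_H w.2.1, by have := w.2.2; simp only [rho]; omega⟩
  invFun w := ⟨rho n w.1, rho_H w.2.1, by have := w.2.2; simp only [rho]; omega⟩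
  left_inv w := Subtype.ext (rho_rho n w.1)
  right_inv w := Subtype.ext (rho_rho n w.1)

def rhoB (m n : ℕ) : Bu m n ≃ Bu m n where
  toFun w := ⟨rho n w.1, rho_H w.2.1, by have := w.2.2; simp only [rho]; omega⟩
  invFun w := ⟨rho n w.1, rho_H w.2.1, by have := w.2.2; simp only [rho]; omega⟩
  left_inv w := Subtype.ext (rho_rho n w.1)
  right_inv w := Subtype.ext (rho_rho n w.1)

def rhoD (m n : ℕ) : De m n ≃ Do m n where
  toFun w := ⟨rho n w.1, rho_H w.2.1, by have := w.2.2; simp only [rho]; omega⟩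
  invFun w := ⟨rho n w.1, rho_H w.2.1, by have := w.2.2; simp only [rho]; omega⟩
  left_inv w := Subtype.ext (rho_rho n w.1)
  right_inv w := Subtype.ext (rho_rho n w.1)

def mir (m n : ℕ) : Wh m n ≃ Bh m n where
  toFun w := ⟨(2 * n - 1 - w.1.1, w.1.2), by
    have h := w.2; rw [mem_H] at *; unfold InQ InO at *; simp only; omega⟩
  invFun w := ⟨(2 * n - 1 - w.1.1, w.1.2), by
    have h := w.2; rw [mem_H] at *; unfold InQ InO at *; simp only; omega⟩
  left_inv w := by apply Subtype.ext; ext <;> simp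
  right_inv w := by apply Subtype.ext; ext <;> simp

lemma card_eq (m n : ℕ) : Fintype.card (Wu m n ⊕ De m n) = Fintype.card (Bu m n) := by
  have h1 := Fintype.card_congr (Equiv.ofBijective _ (fW_bij m n))
  have h2 := Fintype.card_congr (Equiv.ofBijective _ (fB_bij m n))
  have h3 := Fintype.card_congr (mir m n)
  have h4 := Fintype.card_congr (rhoD m n)
  simp only [Fintype.card_sum] at *
  omega

def dc (n : ℕ) (i : ℤ) : ℤ × ℤ :=
  if i % 2 = 0 then (i, i) else (2 * n - 1 - i, 2 * n - 1 - i)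

lemma card_De {m n : ℕ} (h : m < n) : Fintype.card (De m n) = n - m := by
  let F : Fin (n - m) → De m n := fun i => ⟨dc n (i : ℕ), by
    have hi := i.2
    have hi' : ((i : ℕ) : ℤ) < n - m := by omega
    rw [mem_H]; unfold dc InQ InO; split_ifs <;> simp only [and_true] <;> omega⟩
  have hF : Function.Bijective F := by
    constructor
    · intro i j hij
      have := i.2
      have := j.2
      have h' : dc n (i : ℕ) = dc n (j : ℕ) := congrArg Subtype.val hij
      unfold dc at h'
      apply Fin.ext
      split_ifs at h' <;> simp only [Prod.mk.injEq] at h' <;> omega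
    · rintro ⟨⟨x, y⟩, h1, h2, h3⟩
      simp only at h2 h3
      subst h3
      rw [mem_H] at h1; unfold InQ InO at h1; simp only at h1
      by_cases hx : x < n - m
      · refine ⟨⟨x.toNat, by omega⟩, Subtype.ext ?_⟩
        simp only [F, dc]
        rw [if_pos (by omega)]
        simp only [Prod.mk.injEq]; omega
      · refine ⟨⟨(2 * n - 1 - x).toNat, by omega⟩, Subtype.ext ?_⟩
        simp only [F, dc]
        rw [if_neg (by omega)]
        simp only [Prod.mk.injEq]; omega
  rw [← Fintype.card_congr (Equiv.ofBijective F hF)]; simp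

noncomputable def PM (m n : ℕ) : Matrix (Wu m n) (Bu m n) ℤ := of fun w b => kw n w.1 b.1
noncomputable def RE (m n : ℕ) : Matrix (De m n) (Bu m n) ℤ := of fun w b => kw n w.1 b.1
noncomputable def RO (m n : ℕ) : Matrix (Do m n) (Bu m n) ℤ := of fun w b => kw n w.1 b.1

abbrev GW (m n : ℕ) : Matrix (Wu m n) (Wu m n) ℤ := diagonal fun w => gS w.1
abbrev GB (m n : ℕ) : Matrix (Bu m n) (Bu m n) ℤ := diagonal fun b => gS b.1

lemma inQ_of {m n : ℕ} {c : ℤ × ℤ} (h : c ∈ holeySquare m n) : InQ n c := (mem_H.1 h).1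

lemma swap_diag {c : ℤ × ℤ} (h : c.1 = c.2) : c.swap = c := by
  ext <;> simp [h]

lemma entry (m n : ℕ) (r : (Wu m n ⊕ De m n) ⊕ (Wu m n ⊕ Do m n)) (b : Bu m n ⊕ Bu m n) :
    kw n (fW m n r).1 (fB m n b).1 =
    fromBlocks (fromRows (PM m n) (RE m n))
      (fromRows 0 (RE m n * GB m n)) (fromRows 0 (RO m n))
      (fromRows (GW m n * PM m n * GB m n)
        (-(RO m n * GB m n))) r b := by
  rcases r with (w | w) | (w | w) <;> rcases b with b | b <;>
    simp only [fW, fB, GW, GB, fromBlocks_apply₁₁, fromBlocks_apply₁₂, fromBlocks_apply₂₁,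
      fromBlocks_apply₂₂, fromRows_apply_inl, fromRows_apply_inr, Matrix.neg_apply,
      mul_diagonal, diagonal_mul, PM, RE, RO, of_apply, Matrix.zero_apply]
  · apply kw0
    have := w.2.2; have := b.2.2
    unfold Adjacent; simp only [Prod.fst_swap, Prod.snd_swap]; omega
  · have h := kw_swap (b := b.1) (inQ_of w.2.1)
    have h' : gS w.1 = 1 := by have := w.2.2; unfold gS; rw [if_neg (by omega)]
    rw [swap_diag w.2.2.2, h'] at h
    rw [h]; ring
  · apply kw0
    have := w.2.2; have := b.2.2
    unfold Adjacent; simp only [Prod.fst_swap, Prod.snd_swap]; omega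
  · rw [kw_swap (inQ_of w.2.1)]; ring
  · have h := kw_swap (b := b.1) (inQ_of w.2.1)
    have h' : gS w.1 = -1 := by have := w.2.2; unfold gS; rw [if_pos (by omega)]
    rw [swap_diag w.2.2.2, h'] at h
    rw [h]; ring

lemma rho_rows (m n : ℕ) (r : Wu m n ⊕ De m n) (b : Bu m n) :
    fromRows (PM m n) (RO m n) (Equiv.sumCongr (rhoW m n) (rhoD m n) r) (rhoB m n b) =
    Sum.elim (fun w => hS w.1) (fun w => hS w.1) r * fromRows (PM m n) (RE m n) r b * hS b.1 := by
  rcases r with w | w <;> simp [PM, RE, RO, rhoW, rhoD, rhoB] <;>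
    rw [kw_rho (inQ_of w.2.1)] <;> ring

lemma factor {m n : ℕ} (h : m < n) (ε : Wu m n ⊕ De m n ≃ Bu m n) :
    (numTilings (holeySquare m n) : ℤ) =
      2 ^ (n - m) * ((fromRows (PM m n) (RE m n)).submatrix id ε).det ^ 2 := by
  let rr := Equiv.sumCongr (rhoW m n) (rhoD m n)
  let ε' : Wu m n ⊕ Do m n ≃ Bu m n := rr.symm.trans (ε.trans (rhoB m n))
  let rW := Equiv.ofBijective _ (fW_bij m n)
  let rB := Equiv.ofBijective _ (fB_bij m n)
  let e0 : Wh m n ≃ Bh m n := rW.symm.trans ((Equiv.sumCongr ε ε').trans rB)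
  have hb := block_det (PM m n) (RE m n) (RO m n) (fun w => gS w.1) (fun b => gS b.1)
    (fun w => gS_cases _) (fun w => gS_cases _) ε ε'
  rw [det_count h.le e0, ← det_submatrix_equiv_self rW]
  have e1 : (Matrix.of fun w w' : Wh m n => kw n w.1 (e0 w').1).submatrix rW rW =
      (fromBlocks (fromRows (PM m n) (RE m n))
      (fromRows 0 (RE m n * GB m n)) (fromRows 0 (RO m n))
      (fromRows (GW m n * PM m n * GB m n)
        (-(RO m n * GB m n)))).submatrix id (Equiv.sumCongr ε ε') := by
    ext r r'
    rw [submatrix_apply, submatrix_apply, of_apply, ← entry]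
    simp only [e0, Equiv.trans_apply, Equiv.symm_apply_apply]
    rfl
  rw [e1, hb, card_De h]
  have e2 : ((fromRows (PM m n) (RO m n)).submatrix id ε').submatrix rr rr =
      (diagonal (Sum.elim (fun w => hS w.1) (fun w => hS w.1)) : Matrix (Wu m n ⊕ De m n) _ ℤ) *
        (fromRows (PM m n) (RE m n)).submatrix id ε * diagonal (fun i => hS (ε i).1) := by
    ext r r'
    rw [mul_diagonal, diagonal_mul, submatrix_apply, submatrix_apply, submatrix_apply]
    simp only [ε', Equiv.trans_apply, Equiv.symm_apply_apply]
    exact rho_rows m n r (ε r')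
  have e3 : |((fromRows (PM m n) (RO m n)).submatrix id ε').det| =
      |((fromRows (PM m n) (RE m n)).submatrix id ε).det| := by
    rw [← det_submatrix_equiv_self rr, e2, det_mul, det_mul, det_diagonal, det_diagonal, abs_mul,
      abs_mul, Finset.abs_prod, Finset.abs_prod, Finset.prod_eq_one, Finset.prod_eq_one]
    · ring
    · intro i _
      rcases hS_cases (ε i).1 with h | h <;> simp [h]
    · rintro (i | i) _ <;> rcases hS_cases i.1 with h | h <;> simp [h]
  rw [e3, mul_assoc, abs_mul_abs_self, sq]

end HS

namespace HS
open Matrix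

def Up (m n : ℕ) (x y : ℤ) : Prop :=
  0 ≤ x ∧ x < y ∧ y < 2 * n ∧ (x < (n : ℤ) - m ∨ (n : ℤ) + m ≤ y)

lemma anti_zero {m n : ℕ} (h : m < n) (g : ℤ → ℤ → ZMod 2)
    (hs : ∀ x y, ¬ (Up m n x y ∧ (x + y) % 2 = 1) → g x y = 0)
    (hh : ∀ x y, Up m n x y → (x + y) % 2 = 0 →
      g (x + 1) y + g (x - 1) y + g x (y + 1) + g x (y - 1) = 0)
    (h0 : ∀ x, g x (2 * n - 1 - x) = 0) (k : ℕ) :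
    ∀ x y : ℤ, y = 2 * n - 1 - x - 2 * k → g x y = 0 := by
  induction k with
  | zero => intro x y hy; rw [hy]; simpa using h0 x
  | succ k ih =>
    have key : ∀ i : ℕ, ∀ y : ℤ, y = 2 * n - 1 - i - 2 * (k + 1 : ℕ) → g i y = 0 := by
      intro i
      induction i with
      | zero =>
        intro y hy
        by_cases hu : Up m n (0 : ℕ) y
        · unfold Up at hu
          have e := hh (0 : ℕ) (y + 1) (by unfold Up; omega) (by omega)
          rw [ih _ (y + 1) (by push_cast at *; omega), hs _ (y + 1) (by unfold Up; omega),
            ih _ (y + 1 + 1) (by push_cast at *; omega)] at e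
          simpa using e
        · exact hs _ _ (fun h => hu h.1)
      | succ i ihi =>
        intro y hy
        by_cases hu : Up m n (i + 1 : ℕ) y
        · unfold Up at hu
          have e := hh (i + 1 : ℕ) (y + 1) (by unfold Up; omega) (by omega)
          rw [ih _ (y + 1) (by push_cast at *; omega),
            ih _ (y + 1 + 1) (by push_cast at *; omega)] at e
          have e' := ihi (y + 1) (by push_cast at *; omega)
          rw [show (((i + 1 : ℕ) : ℤ) - 1) = i by push_cast; ring, e'] at e
          simpa using e
        · exact hs _ _ (fun h => hu h.1)
    intro x y hy
    rcases lt_or_ge x 0 with hx | hx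
    · exact hs _ _ (by unfold Up; omega)
    · obtain ⟨i, rfl⟩ := Int.eq_ofNat_of_zero_le hx
      exact key i y hy

lemma kernel_zero {m n : ℕ} (h : m < n) (f : ℤ → ℤ → ZMod 2)
    (hs : ∀ x y, ¬ (Up m n x y ∧ (x + y) % 2 = 1) → f x y = 0)
    (hh : ∀ x y, Up m n x y → (x + y) % 2 = 0 →
      f (x + 1) y + f (x - 1) y + f x (y + 1) + f x (y - 1) = 0)
    (hd : ∀ x : ℤ, 0 ≤ x → x < 2 * n → (x < (n : ℤ) - m ∨ (n : ℤ) + m ≤ x) → x % 2 = 0 →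
      f x (x + 1) + f (x - 1) x = 0) (x y : ℤ) : f x y = 0 := by
  have two : ∀ a b : ZMod 2, a + b = 0 ↔ a = b := by decide
  have sym : ∀ x y : ℤ, f x y = f (2 * n - 1 - y) (2 * n - 1 - x) := by
    let g : ℤ → ℤ → ZMod 2 := fun x y => f x y + f (2 * n - 1 - y) (2 * n - 1 - x)
    have hg := anti_zero h g
      (by
        intro x y hxy
        simp only [g]
        rw [hs _ _ hxy, hs _ _ (by unfold Up at *; omega), add_zero])
      (by
        intro x y h1 h2
        have e1 := hh x y h1 h2
        have e2 := hh (2 * n - 1 - y) (2 * n - 1 - x) (by unfold Up at *; omega) (by omega)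
        simp only [g]
        rw [show (2 * n - 1 - (x + 1) : ℤ) = 2 * n - 1 - x - 1 by ring,
          show (2 * n - 1 - (x - 1) : ℤ) = 2 * n - 1 - x + 1 by ring,
          show (2 * n - 1 - (y + 1) : ℤ) = 2 * n - 1 - y - 1 by ring,
          show (2 * n - 1 - (y - 1) : ℤ) = 2 * n - 1 - y + 1 by ring]
        linear_combination e1 + e2)
      (by
        intro x
        simp only [g]
        rw [show (2 * n - 1 - (2 * n - 1 - x) : ℤ) = x by ring, two])
    intro x y
    by_cases hb : (x + y) % 2 = 1
    · rcases le_total (x + y) (2 * n - 1) with hl | hl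
      · have := hg ((2 * n - 1 - x - y) / 2).toNat x y (by omega)
        exact (two _ _).1 this
      · have := hg ((x + y - (2 * n - 1)) / 2).toNat (2 * n - 1 - y) (2 * n - 1 - x) (by omega)
        simp only [g] at this
        rw [show (2 * n - 1 - (2 * n - 1 - x) : ℤ) = x by ring,
          show (2 * n - 1 - (2 * n - 1 - y) : ℤ) = y by ring] at this
        exact ((two _ _).1 this).symm
    · rw [hs _ _ (by omega), hs _ _ (by omega)]
  have hd' : ∀ x : ℤ, 0 ≤ x → x < (n : ℤ) - m → f x (x + 1) = f (x - 1) x := by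
    intro x h0 h1
    rw [← two]
    rcases Int.emod_two_eq_zero_or_one x with hx | hx
    · exact hd x h0 (by omega) (by omega) hx
    · have e := hd (2 * n - 1 - x) (by omega) (by omega) (by omega) (by omega)
      rw [sym x, sym (x - 1)]
      rw [show (2 * n - 1 - (x + 1) : ℤ) = 2 * n - 1 - x - 1 by ring,
          show (2 * n - 1 - (x - 1) : ℤ) = 2 * n - 1 - x + 1 by ring, add_comm]
      exact e
  have main : ∀ j : ℕ, ∀ x y : ℤ, y = x + 2 * j + 1 → f x y = 0 := by
    intro j
    induction j with
    | zero =>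
      have key : ∀ i : ℕ, (i : ℤ) < (n : ℤ) - m → f i (i + 1) = 0 := by
        intro i
        induction i with
        | zero =>
          intro hi
          rw [hd' _ (by omega) hi]
          exact hs _ _ (by unfold Up; omega)
        | succ i ihi =>
          intro hi
          rw [hd' _ (by omega) hi, ← ihi (by omega)]
          push_cast; congr 1; ring
      have key' : ∀ x : ℤ, x < (n : ℤ) - m → f x (x + 1) = 0 := by
        intro x hx
        rcases lt_or_ge x 0 with h' | h'
        · exact hs _ _ (by unfold Up; omega)
        · obtain ⟨i, rfl⟩ := Int.eq_ofNat_of_zero_le h'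
          exact key i hx
      intro x y hy
      obtain rfl : y = x + 1 := by simpa using hy
      rcases lt_or_ge x ((n : ℤ) - m) with hx | hx
      · exact key' x hx
      · by_cases hy' : (n : ℤ) + m ≤ x + 1
        · rw [sym, show (2 * n - 1 - x : ℤ) = 2 * n - 1 - (x + 1) + 1 by ring]
          exact key' _ (by omega)
        · exact hs _ _ (by unfold Up; omega)
    | succ j ih =>
      have step : ∀ x y : ℤ, 0 ≤ x → x < (n : ℤ) - m → y = x + 2 * (j + 1 : ℕ) + 1 →
          y < 2 * n → f x y = f (x - 1) (y - 1) := by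
        intro x y h0 h1 hy hu
        have e := hh x (y - 1) (by unfold Up; omega) (by omega)
        rw [ih (x + 1) (y - 1) (by push_cast at *; omega),
          ih x (y - 1 - 1) (by push_cast at *; omega), sub_add_cancel] at e
        rw [← two]; linear_combination e
      have key : ∀ i : ℕ, ∀ y : ℤ, (i : ℤ) < (n : ℤ) - m → y = i + 2 * (j + 1 : ℕ) + 1 →
          f i y = 0 := by
        intro i
        induction i with
        | zero =>
          intro y hi hy
          by_cases hu : y < 2 * n
          · rw [step _ y (by omega) hi hy hu]
            exact hs _ _ (by unfold Up; omega)
          · exact hs _ _ (by unfold Up; omega)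
        | succ i ihi =>
          intro y hi hy
          by_cases hu : y < 2 * n
          · rw [step _ y (by omega) hi hy hu, ← ihi (y - 1) (by omega) (by push_cast at *; omega)]
            push_cast; congr 1; ring
          · exact hs _ _ (by unfold Up; omega)
      have key' : ∀ x y : ℤ, x < (n : ℤ) - m → y = x + 2 * (j + 1 : ℕ) + 1 → f x y = 0 := by
        intro x y hx hy
        rcases lt_or_ge x 0 with h' | h'
        · exact hs _ _ (by unfold Up; omega)
        · obtain ⟨i, rfl⟩ := Int.eq_ofNat_of_zero_le h'
          exact key i y hx hy
      intro x y hy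
      rcases lt_or_ge x ((n : ℤ) - m) with hx | hx
      · exact key' x y hx hy
      · by_cases hy' : (n : ℤ) + m ≤ y
        · rw [sym]
          exact key' _ _ (by omega) (by omega)
        · exact hs _ _ (by unfold Up; omega)
  by_cases hxy : Up m n x y ∧ (x + y) % 2 = 1
  · have := hxy.1; unfold Up at this
    exact main ((y - x - 1) / 2).toNat x y (by omega)
  · exact hs _ _ hxy

lemma kw_mod (n : ℕ) (x y : ℤ) (b : ℤ × ℤ) : ((kw n (x, y) b : ℤ) : ZMod 2) =
    (if b = (x + 1, y) then 1 else 0) + (if b = (x - 1, y) then 1 else 0) +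
    (if b = (x, y + 1) then 1 else 0) + (if b = (x, y - 1) then 1 else 0) := by
  by_cases h : Adjacent (x, y) b
  · have : ((kw n (x, y) b : ℤ) : ZMod 2) = 1 := by
      rw [kw, if_pos h]
      rcases Int.units_eq_one_or (sg (pos n (x, y)) (pos n b)) with e | e <;> rw [e] <;> decide
    rw [this]
    rcases adj_cases h with rfl | rfl | rfl | rfl <;> simp <;> omega
  · rw [kw0 h, if_neg, if_neg, if_neg, if_neg]
    · simp
    all_goals rintro rfl; apply h; unfold Adjacent; simp

lemma det_odd {m n : ℕ} (h : m < n) (ε : Wu m n ⊕ De m n ≃ Bu m n) :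
    ¬ (2 : ℤ) ∣ ((fromRows (PM m n) (RE m n)).submatrix id ε).det := by
  classical
  intro hdvd
  set M := (fromRows (PM m n) (RE m n)).submatrix id ε with hM
  have h1 : (M.map (Int.castRingHom (ZMod 2))).det = 0 := by
    rw [← RingHom.mapMatrix_apply, ← RingHom.map_det]
    exact (ZMod.intCast_zmod_eq_zero_iff_dvd _ 2).2 hdvd
  obtain ⟨v, hv, hMv⟩ := exists_mulVec_eq_zero_iff.2 h1
  let f : ℤ → ℤ → ZMod 2 := fun x y =>
    if hc : (x, y) ∈ holeySquare m n ∧ (x + y) % 2 = 1 ∧ x < y then v (ε.symm ⟨(x, y), hc⟩) else 0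
  have hsum : ∀ x y : ℤ, ∑ b : Bu m n, (if b.1 = (x, y) then (1 : ZMod 2) else 0) * v (ε.symm b) =
      f x y := by
    intro x y
    by_cases hc : (x, y) ∈ holeySquare m n ∧ (x + y) % 2 = 1 ∧ x < y
    · rw [Finset.sum_eq_single (⟨(x, y), hc⟩ : Bu m n)]
      · simp [f, hc]
      · intro b _ hb
        rw [if_neg, zero_mul]
        intro e; exact hb (Subtype.ext e)
      · simp
    · simp only [f, dif_neg hc]
      apply Finset.sum_eq_zero
      intro b _
      rw [if_neg, zero_mul]
      intro e; apply hc; have := b.2; rw [e] at this; exact this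
  have hrow : ∀ (r : Wu m n ⊕ De m n) (x y : ℤ), Sum.elim (fun w => w.1) (fun w => w.1) r = (x, y) →
      f (x + 1) y + f (x - 1) y + f x (y + 1) + f x (y - 1) = 0 := by
    intro r x y hr
    have e := congrFun hMv r
    simp only [mulVec, dotProduct, Pi.zero_apply] at e
    rw [← Equiv.sum_comp ε.symm] at e
    rw [← hsum, ← hsum, ← hsum, ← hsum, ← Finset.sum_add_distrib, ← Finset.sum_add_distrib,
      ← Finset.sum_add_distrib]
    refine Eq.trans ?_ e
    apply Finset.sum_congr rfl
    intro b _
    rw [← add_mul, ← add_mul, ← add_mul, ← kw_mod n, ← hr]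
    congr 1
    rcases r with r | r <;> simp [hM, PM, RE]
  have hf := kernel_zero h f
    (by
      intro x y hxy
      simp only [f]
      rw [dif_neg]
      intro hc; apply hxy
      rw [mem_H] at hc; unfold InQ InO at hc; unfold Up; simp only at hc; omega)
    (by
      intro x y hu hp
      unfold Up at hu
      exact hrow (.inl ⟨(x, y), by rw [mem_H]; unfold InQ InO; simp only; omega⟩) x y rfl)
    (by
      intro x h0 h1 h2 h3
      have e := hrow (.inr ⟨(x, x), by rw [mem_H]; unfold InQ InO; simp only [and_true]; omega⟩) x x rfl
      have z1 : f (x + 1) x = 0 := dif_neg (by omega)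
      have z2 : f x (x - 1) = 0 := dif_neg (by omega)
      rw [z1, z2] at e
      linear_combination e)
  apply hv
  funext r
  have := hf (ε r).1.1 (ε r).1.2
  simp only [f] at this
  rw [dif_pos (ε r).2] at this
  simpa using this
end HS

theorem holey_square_conjecture (m n : ℕ) (hm : 1 ≤ m) (hmn : m < n) :
    ∃ k : ℕ, numTilings (holeySquare m n) = 2 ^ (n - m) * (2 * k + 1) ^ 2 := by
  let ε := Fintype.equivOfCardEq (HS.card_eq m n)
  have h1 := HS.factor hmn ε
  have h2 := HS.det_odd hmn ε
  generalize ((Matrix.fromRows (HS.PM m n) (HS.RE m n)).submatrix id ε).det = d at h1 h2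
  refine ⟨d.natAbs / 2, ?_⟩
  have h3 : 2 * (d.natAbs / 2) + 1 = d.natAbs := by omega
  rw [h3]
  zify
  rw [h1, sq_abs]
end
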